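/- Fix an integer n ≥ 3. For every integer i ≥ 0, the singular homology group H_i(M(𝓓_{n,3}); ℤ) is torsion free. -/

import Mathlib

open CategoryTheory

/-- The singular chain complex of a topological space with `ℤ` coefficients. -/
noncomputable def singularChainComplex (X : TopCat) : ChainComplex (ModuleCat ℤ) ℕ :=
  (AlgebraicTopology.alternatingFaceMapComplex (ModuleCat ℤ)).obj
    (((SimplicialObject.whiskering _ _).obj (ModuleCat.free ℤ)).obj (TopCat.toSSet.obj X))

/-- The `i`-th singular homology of a topological space with `ℤ` coefficients. -/
noncomputable def singularHomology (X : TopCat) (i : ℕ) : ModuleCat ℤ :=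
  (singularChainComplex X).homology i

/-- The complement of the type-`D` `3`-parabolic arrangement `𝓓_{n,3}` in `ℝⁿ`:
points avoiding all subspaces `ε₁ x_i = ε₂ x_j = ε₃ x_l` over triples `i < j < l`
and signs `ε₁, ε₂, ε₃ ∈ {±1}`. -/
def typeDComplement (n : ℕ) : Set (Fin n → ℝ) :=
  {x | ∀ i j l : Fin n, i < j → j < l →
        ∀ ε₁ ε₂ ε₃ : ℝ, (ε₁ = 1 ∨ ε₁ = -1) → (ε₂ = 1 ∨ ε₂ = -1) → (ε₃ = 1 ∨ ε₃ = -1) →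
          ¬ (ε₁ * x i = ε₂ * x j ∧ ε₂ * x j = ε₃ * x l)}

namespace TypeD

/-- Chains of tuples of points. -/
abbrev LC (Y : Type*) (k : ℕ) := (Fin (k + 1) → Y) →₀ ℤ

section LC
variable {Y Y' : Type*}

/-- The boundary of tuple chains. -/
noncomputable def lbd (Y : Type*) (k : ℕ) : LC Y (k + 1) →ₗ[ℤ] LC Y k :=
  Finsupp.linearCombination ℤ fun v =>
    ∑ i : Fin (k + 2), (-1 : ℤ) ^ (i : ℕ) • Finsupp.single (v ∘ i.succAbove) (1 : ℤ)

lemma lbd_single (k : ℕ) (v : Fin (k + 2) → Y) :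
    lbd Y k (Finsupp.single v 1) =
      ∑ i : Fin (k + 2), (-1 : ℤ) ^ (i : ℕ) • Finsupp.single (v ∘ i.succAbove) (1 : ℤ) := by
  simp [lbd]

/-- The cone operator. -/
noncomputable def cone (b : Y) (k : ℕ) : LC Y k →ₗ[ℤ] LC Y (k + 1) :=
  Finsupp.linearCombination ℤ fun v => Finsupp.single (Fin.cons b v : Fin (k + 2) → Y) (1 : ℤ)

lemma cone_single (b : Y) (k : ℕ) (v : Fin (k + 1) → Y) :
    cone b k (Finsupp.single v 1) = Finsupp.single (Fin.cons b v : Fin (k + 2) → Y) (1 : ℤ) := by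
  simp [cone]

/-- The augmentation. -/
noncomputable def aug (Y : Type*) : LC Y 0 →ₗ[ℤ] ℤ :=
  Finsupp.linearCombination ℤ fun _ => (1 : ℤ)

/-- Functoriality of tuple chains. -/
noncomputable def lmap (f : Y → Y') (k : ℕ) : LC Y k →ₗ[ℤ] LC Y' k :=
  Finsupp.linearCombination ℤ fun v => Finsupp.single (f ∘ v) (1 : ℤ)

lemma lmap_single (f : Y → Y') (k : ℕ) (v : Fin (k + 1) → Y) :
    lmap f k (Finsupp.single v 1) = Finsupp.single (f ∘ v) (1 : ℤ) := by
  simp [lmap]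

/-- Extensionality for linear maps on free modules. -/
lemma hom_ext1 {X M : Type*} [AddCommGroup M] {f g : (X →₀ ℤ) →ₗ[ℤ] M}
    (h : ∀ x, f (Finsupp.single x 1) = g (Finsupp.single x 1)) (c : X →₀ ℤ) : f c = g c := by
  have : f = g := by
    apply Finsupp.lhom_ext'
    intro x
    apply LinearMap.ext_ring
    exact h x
  rw [this]

lemma cons_comp_succ (k : ℕ) (b : Y) (v : Fin (k + 2) → Y) (j : Fin (k + 2)) :
    (Fin.cons b v : Fin (k + 3) → Y) ∘ (Fin.succ j).succAbove
      = (Fin.cons b (v ∘ j.succAbove) : Fin (k + 2) → Y) := by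
  funext i
  refine Fin.cases ?_ (fun i => ?_) i
  · simp
  · simp [Fin.succ_succAbove_succ]

lemma lbd_cone (k : ℕ) (b : Y) (c : LC Y (k + 1)) :
    lbd Y (k + 1) (cone b (k + 1) c) = c - cone b k (lbd Y k c) := by
  refine hom_ext1 (f := (lbd Y (k + 1)).comp (cone b (k + 1)))
    (g := LinearMap.id - (cone b k).comp (lbd Y k)) (fun v => ?_) c
  simp only [LinearMap.comp_apply, LinearMap.sub_apply, LinearMap.id_apply, cone_single,
    lbd_single, map_sum, map_smul]
  rw [Fin.sum_univ_succ]
  simp only [cons_comp_succ]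
  have : (Fin.cons b v : Fin (k + 3) → Y) ∘ (Fin.succAbove 0) = v := by
    funext i; simp
  rw [this, sub_eq_add_neg, ← Finset.sum_neg_distrib]
  simp [pow_succ]

lemma lbd_cone_zero (b : Y) (c : LC Y 0) :
    lbd Y 0 (cone b 0 c) = c - aug Y c • Finsupp.single (fun _ => b) 1 := by
  refine hom_ext1 (f := (lbd Y 0).comp (cone b 0))
    (g := LinearMap.id - (aug Y).smulRight (Finsupp.single (fun _ => b) (1 : ℤ))) (fun v => ?_) c
  simp only [LinearMap.comp_apply, LinearMap.sub_apply, LinearMap.id_apply, cone_single,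
    lbd_single]
  rw [Fin.sum_univ_succ]
  have : (Fin.cons b v : Fin 2 → Y) ∘ (Fin.succAbove 0) = v := by
    funext i; simp
  have h2 : (Fin.cons b v : Fin 2 → Y) ∘ (Fin.succAbove (Fin.succ 0)) = fun _ => b := by
    funext i; fin_cases i; simp
  rw [this, Fin.sum_univ_one, h2]
  simp [aug, sub_eq_add_neg]

lemma aug_lbd (c : LC Y 1) : aug Y (lbd Y 0 c) = 0 := by
  refine hom_ext1 (f := (aug Y).comp (lbd Y 0)) (g := 0) (fun v => ?_) c
  simp [lbd_single, aug, Fin.sum_univ_succ]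

lemma single_eq_cone (k : ℕ) (v : Fin (k + 2) → Y) :
    (Finsupp.single v 1 : LC Y (k + 1)) = cone (v 0) k (Finsupp.single (Fin.tail v) 1) := by
  rw [cone_single, Fin.cons_self_tail]

lemma lbd_lbd (k : ℕ) (c : LC Y (k + 2)) : lbd Y k (lbd Y (k + 1) c) = 0 := by
  induction k with
  | zero =>
    refine hom_ext1 (f := (lbd Y 0).comp (lbd Y 1)) (g := 0) (fun v => ?_) c
    rw [single_eq_cone]
    simp [lbd_cone, lbd_cone_zero, aug_lbd]
  | succ k ih =>
    refine hom_ext1 (f := (lbd Y (k + 1)).comp (lbd Y (k + 2))) (g := 0) (fun v => ?_) c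
    rw [single_eq_cone]
    simp [lbd_cone, ih]

lemma lbd_lmap (f : Y → Y') (k : ℕ) (c : LC Y (k + 1)) :
    lbd Y' k (lmap f (k + 1) c) = lmap f k (lbd Y k c) := by
  refine hom_ext1 (f := (lbd Y' k).comp (lmap f (k + 1)))
    (g := (lmap f k).comp (lbd Y k)) (fun v => ?_) c
  simp only [LinearMap.comp_apply, lmap_single, lbd_single, map_sum, map_smul, Function.comp_assoc]

lemma lmap_cone (f : Y → Y') (b : Y) (k : ℕ) (c : LC Y k) :
    lmap f (k + 1) (cone b k c) = cone (f b) k (lmap f k c) := by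
  refine hom_ext1 (f := (lmap f (k + 1)).comp (cone b k))
    (g := (cone (f b) k).comp (lmap f k)) (fun v => ?_) c
  simp only [LinearMap.comp_apply, lmap_single, cone_single]
  congr 1
  funext i
  refine Fin.cases ?_ (fun i => ?_) i <;> simp

lemma aug_lmap (f : Y → Y') (c : LC Y 0) : aug Y' (lmap f 0 c) = aug Y c := by
  refine hom_ext1 (f := (aug Y').comp (lmap f 0)) (g := aug Y) (fun v => ?_) c
  simp [lmap_single, aug]

/-- Subdivision with respect to a choice of centres. -/
noncomputable def lsd (β : ∀ k : ℕ, (Fin (k + 1) → Y) → Y) : ∀ k : ℕ, LC Y k →ₗ[ℤ] LC Y k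
  | 0 => LinearMap.id
  | k + 1 => Finsupp.linearCombination ℤ fun v =>
      cone (β (k + 1) v) k (lsd β k (lbd Y k (Finsupp.single v 1)))

lemma lsd_single (β : ∀ k : ℕ, (Fin (k + 1) → Y) → Y) (k : ℕ) (v : Fin (k + 2) → Y) :
    lsd β (k + 1) (Finsupp.single v 1) =
      cone (β (k + 1) v) k (lsd β k (lbd Y k (Finsupp.single v 1))) := by
  rw [lsd]; simp

lemma lbd_lsd (β : ∀ k : ℕ, (Fin (k + 1) → Y) → Y) (k : ℕ) (c : LC Y (k + 1)) :
    lbd Y k (lsd β (k + 1) c) = lsd β k (lbd Y k c) := by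
  induction k with
  | zero =>
    refine hom_ext1 (f := (lbd Y 0).comp (lsd β 1)) (g := (lsd β 0).comp (lbd Y 0))
      (fun v => ?_) c
    simp only [LinearMap.comp_apply, lsd_single, lbd_cone_zero]
    simp [lsd, aug_lbd]
  | succ k ih =>
    refine hom_ext1 (f := (lbd Y (k + 1)).comp (lsd β (k + 2)))
      (g := (lsd β (k + 1)).comp (lbd Y (k + 1))) (fun v => ?_) c
    simp only [LinearMap.comp_apply, lsd_single β (k + 1), lbd_cone, ih, lbd_lbd]
    simp

lemma lmap_lsd (β : ∀ k : ℕ, (Fin (k + 1) → Y) → Y) (β' : ∀ k : ℕ, (Fin (k + 1) → Y') → Y')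
    (f : Y → Y') (hf : ∀ k v, f (β k v) = β' k (f ∘ v)) (k : ℕ) (c : LC Y k) :
    lmap f k (lsd β k c) = lsd β' k (lmap f k c) := by
  induction k with
  | zero => simp [lsd]
  | succ k ih =>
    refine hom_ext1 (f := (lmap f (k + 1)).comp (lsd β (k + 1)))
      (g := (lsd β' (k + 1)).comp (lmap f (k + 1))) (fun v => ?_) c
    simp only [LinearMap.comp_apply, lsd_single, lmap_cone, ih, hf, lmap_single, ← lbd_lmap]

/-- The cone homotopy between two chain maps `φ` and `ψ`. -/
noncomputable def lhom (b : ∀ k : ℕ, (Fin (k + 1) → Y) → Y')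
    (φ ψ : ∀ k : ℕ, LC Y k →ₗ[ℤ] LC Y' k) : ∀ k : ℕ, LC Y k →ₗ[ℤ] LC Y' (k + 1)
  | 0 => Finsupp.linearCombination ℤ fun v =>
      cone (b 0 v) 0 (φ 0 (Finsupp.single v 1) - ψ 0 (Finsupp.single v 1))
  | k + 1 => Finsupp.linearCombination ℤ fun v =>
      cone (b (k + 1) v) (k + 1) (φ (k + 1) (Finsupp.single v 1) - ψ (k + 1) (Finsupp.single v 1)
        - lhom b φ ψ k (lbd Y k (Finsupp.single v 1)))

lemma lhom_single_zero (b : ∀ k : ℕ, (Fin (k + 1) → Y) → Y')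
    (φ ψ : ∀ k : ℕ, LC Y k →ₗ[ℤ] LC Y' k) (v : Fin 1 → Y) :
    lhom b φ ψ 0 (Finsupp.single v 1) =
      cone (b 0 v) 0 (φ 0 (Finsupp.single v 1) - ψ 0 (Finsupp.single v 1)) := by
  rw [lhom]; simp

lemma lhom_single_succ (b : ∀ k : ℕ, (Fin (k + 1) → Y) → Y')
    (φ ψ : ∀ k : ℕ, LC Y k →ₗ[ℤ] LC Y' k) (k : ℕ) (v : Fin (k + 2) → Y) :
    lhom b φ ψ (k + 1) (Finsupp.single v 1) =
      cone (b (k + 1) v) (k + 1) (φ (k + 1) (Finsupp.single v 1) - ψ (k + 1) (Finsupp.single v 1)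
        - lhom b φ ψ k (lbd Y k (Finsupp.single v 1))) := by
  rw [lhom]; simp

lemma lbd_lhom_zero (b : ∀ k : ℕ, (Fin (k + 1) → Y) → Y')
    (φ ψ : ∀ k : ℕ, LC Y k →ₗ[ℤ] LC Y' k) (h0 : ∀ c, aug Y' (φ 0 c) = aug Y' (ψ 0 c))
    (c : LC Y 0) : lbd Y' 0 (lhom b φ ψ 0 c) = φ 0 c - ψ 0 c := by
  refine hom_ext1 (f := (lbd Y' 0).comp (lhom b φ ψ 0)) (g := φ 0 - ψ 0) (fun v => ?_) c
  simp [lhom_single_zero, lbd_cone_zero, h0]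

lemma lbd_lhom (b : ∀ k : ℕ, (Fin (k + 1) → Y) → Y')
    (φ ψ : ∀ k : ℕ, LC Y k →ₗ[ℤ] LC Y' k) (h0 : ∀ c, aug Y' (φ 0 c) = aug Y' (ψ 0 c))
    (hφ : ∀ k c, lbd Y' k (φ (k + 1) c) = φ k (lbd Y k c))
    (hψ : ∀ k c, lbd Y' k (ψ (k + 1) c) = ψ k (lbd Y k c)) (k : ℕ)
    (c : LC Y (k + 1)) : lbd Y' (k + 1) (lhom b φ ψ (k + 1) c) =
      φ (k + 1) c - ψ (k + 1) c - lhom b φ ψ k (lbd Y k c) := by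
  induction k with
  | zero =>
    refine hom_ext1 (f := (lbd Y' 1).comp (lhom b φ ψ 1))
      (g := φ 1 - ψ 1 - (lhom b φ ψ 0).comp (lbd Y 0)) (fun v => ?_) c
    simp only [LinearMap.comp_apply, LinearMap.sub_apply, lhom_single_succ, lbd_cone, map_sub,
      hφ, hψ, lbd_lhom_zero b φ ψ h0]
    abel
  | succ k ih =>
    refine hom_ext1 (f := (lbd Y' (k + 2)).comp (lhom b φ ψ (k + 2)))
      (g := φ (k + 2) - ψ (k + 2) - (lhom b φ ψ (k + 1)).comp (lbd Y (k + 1))) (fun v => ?_) c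
    simp only [LinearMap.comp_apply, LinearMap.sub_apply, lhom_single_succ b φ ψ (k + 1),
      lbd_cone, map_sub, hφ, hψ, ih, lbd_lbd, map_zero]
    abel

lemma lmap_lhom {X X' : Type*} (b : ∀ k : ℕ, (Fin (k + 1) → Y) → Y')
    (φ ψ : ∀ k : ℕ, LC Y k →ₗ[ℤ] LC Y' k) (b' : ∀ k : ℕ, (Fin (k + 1) → X) → X')
    (φ' ψ' : ∀ k : ℕ, LC X k →ₗ[ℤ] LC X' k) (f : Y → X) (g : Y' → X')
    (hb : ∀ k v, g (b k v) = b' k (f ∘ v))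
    (hφ : ∀ k c, lmap g k (φ k c) = φ' k (lmap f k c))
    (hψ : ∀ k c, lmap g k (ψ k c) = ψ' k (lmap f k c)) (k : ℕ) (c : LC Y k) :
    lmap g (k + 1) (lhom b φ ψ k c) = lhom b' φ' ψ' k (lmap f k c) := by
  induction k with
  | zero =>
    refine hom_ext1 (f := (lmap g 1).comp (lhom b φ ψ 0))
      (g := (lhom b' φ' ψ' 0).comp (lmap f 0)) (fun v => ?_) c
    simp only [LinearMap.comp_apply, lhom_single_zero, lmap_cone, hb, hφ, hψ, lmap_single, map_sub]
  | succ k ih =>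
    refine hom_ext1 (f := (lmap g (k + 2)).comp (lhom b φ ψ (k + 1)))
      (g := (lhom b' φ' ψ' (k + 1)).comp (lmap f (k + 1))) (fun v => ?_) c
    simp only [LinearMap.comp_apply, lhom_single_succ, lmap_cone, hb, hφ, hψ, lmap_single, map_sub,
      ih, ← lbd_lmap]

end LC

end TypeD

namespace TypeD

/-- The standard simplex. -/
abbrev Simp (k : ℕ) := stdSimplex ℝ (Fin (k + 1))

/-- Singular simplices. -/
abbrev Sing (E : Type*) [TopologicalSpace E] (k : ℕ) := C(Simp k, E)

/-- Singular chains. -/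
abbrev SC (E : Type*) [TopologicalSpace E] (k : ℕ) := Sing E k →₀ ℤ

/-- Face inclusions. -/
noncomputable def face (k : ℕ) (i : Fin (k + 2)) : C(Simp k, Simp (k + 1)) :=
  ⟨stdSimplex.map i.succAbove, stdSimplex.continuous_map _⟩

section Aff
variable {W : Type*} [NormedAddCommGroup W] [NormedSpace ℝ W] {K : Set W}
variable {W' : Type*} [NormedAddCommGroup W'] [NormedSpace ℝ W'] {K' : Set W'}


noncomputable def aff (hK : Convex ℝ K) {k : ℕ} (v : Fin (k + 1) → K) : C(Simp k, K) where
  toFun t := ⟨∑ i, t i • (v i : W), hK.sum_mem (fun i _ => t.2.1 i) t.2.2 (fun i _ => (v i).2)⟩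
  continuous_toFun := by
    refine Continuous.subtype_mk ?_ _
    refine continuous_finsetSum _ fun i _ => ?_
    refine Continuous.smul ?_ continuous_const
    exact (continuous_apply i).comp continuous_subtype_val

lemma aff_coe (hK : Convex ℝ K) {k : ℕ} (v : Fin (k + 1) → K) (t : Simp k) :
    (aff hK v t : W) = ∑ i, t i • (v i : W) := rfl

lemma aff_face (hK : Convex ℝ K) {k : ℕ} (v : Fin (k + 2) → K) (i : Fin (k + 2)) :
    (aff hK v).comp (face k i) = aff hK (v ∘ i.succAbove) := by
  ext t
  simp only [ContinuousMap.comp_apply, aff_coe, face, ContinuousMap.coe_mk, stdSimplex.map_coe,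
    FunOnFinite.linearMap_apply_apply, Function.comp_apply, Finset.sum_smul]
  rw [← Finset.sum_fiberwise (s := Finset.univ) (g := i.succAbove)]
  refine Finset.sum_congr rfl fun j _ => Finset.sum_congr rfl fun l hl => ?_
  rw [(Finset.mem_filter.1 hl).2]

/-- The convexity of the standard simplex. -/
lemma hSimp (k : ℕ) : Convex ℝ (stdSimplex ℝ (Fin (k + 1))) := convex_stdSimplex ℝ _

/-- The tuple of vertices. -/
noncomputable def vert (k : ℕ) : Fin (k + 1) → Simp k := fun i => stdSimplex.vertex i

lemma aff_vert (k : ℕ) : aff (hSimp k) (vert k) = ContinuousMap.id _ := by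
  ext t j
  change (Subtype.val (aff (hSimp k) (vert k) t)) j = t j
  rw [aff_coe]
  simp [vert, Finset.sum_apply, Pi.single_apply]

lemma aff_comp_vert (hK : Convex ℝ K) {k : ℕ} (v : Fin (k + 1) → K) :
    (aff hK v) ∘ (vert k) = v := by
  funext i
  apply Subtype.ext
  simp only [Function.comp_apply, aff_coe, vert, stdSimplex.vertex_coe]
  simp [Pi.single_apply]

/-- Affine maps between convex sets. -/
def IsAff (hK : Convex ℝ K) (hK' : Convex ℝ K') (g : K → K') : Prop :=
  ∀ (k : ℕ) (v : Fin (k + 1) → K) (t : Simp k), g (aff hK v t) = aff hK' (g ∘ v) t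

lemma isAff_aff (hK : Convex ℝ K) {p : ℕ} (w : Fin (p + 1) → K) :
    IsAff (hSimp p) hK (aff hK w) := by
  intro k v t
  apply Subtype.ext
  simp only [aff_coe, Function.comp_apply]
  have : ∀ i, (aff (hSimp p) v t) i = ∑ j, t j * v j i := by
    intro i
    change (Subtype.val (aff (hSimp p) v t)) i = _
    rw [aff_coe]
    simp [Finset.sum_apply]
    rfl
  simp only [this, Finset.sum_smul, Finset.smul_sum, mul_smul]
  rw [Finset.sum_comm]

/-- Barycentres. -/
noncomputable def bary (hK : Convex ℝ K) (k : ℕ) (v : Fin (k + 1) → K) : K :=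
  aff hK v stdSimplex.barycenter

variable {E : Type*} [TopologicalSpace E]

/-- Realization of tuple chains as singular chains. -/
noncomputable def real (hK : Convex ℝ K) (G : C(K, E)) (k : ℕ) : LC K k →ₗ[ℤ] SC E k :=
  Finsupp.linearCombination ℤ fun v => Finsupp.single (G.comp (aff hK v)) (1 : ℤ)

lemma real_single (hK : Convex ℝ K) (G : C(K, E)) (k : ℕ) (v : Fin (k + 1) → K) :
    real hK G k (Finsupp.single v 1) = Finsupp.single (G.comp (aff hK v)) (1 : ℤ) := by
  simp [real]

/-- The singular boundary. -/
noncomputable def sbd (E : Type*) [TopologicalSpace E] (k : ℕ) : SC E (k + 1) →ₗ[ℤ] SC E k :=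
  Finsupp.linearCombination ℤ fun σ =>
    ∑ i : Fin (k + 2), (-1 : ℤ) ^ (i : ℕ) • Finsupp.single (σ.comp (face k i)) (1 : ℤ)

lemma sbd_single (k : ℕ) (σ : Sing E (k + 1)) :
    sbd E k (Finsupp.single σ 1) =
      ∑ i : Fin (k + 2), (-1 : ℤ) ^ (i : ℕ) • Finsupp.single (σ.comp (face k i)) (1 : ℤ) := by
  simp [sbd]

lemma sbd_real (hK : Convex ℝ K) (G : C(K, E)) (k : ℕ) (c : LC K (k + 1)) :
    sbd E k (real hK G (k + 1) c) = real hK G k (lbd K k c) := by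
  refine hom_ext1 (f := (sbd E k).comp (real hK G (k + 1)))
    (g := (real hK G k).comp (lbd K k)) (fun v => ?_) c
  simp only [LinearMap.comp_apply, real_single, sbd_single, lbd_single, map_sum, map_smul,
    ContinuousMap.comp_assoc, aff_face]

lemma real_comp (hK : Convex ℝ K) (hK' : Convex ℝ K') (G : C(K', E)) (g : C(K, K'))
    (hg : IsAff hK hK' g) (k : ℕ) (c : LC K k) :
    real hK (G.comp g) k c = real hK' G k (lmap g k c) := by
  refine hom_ext1 (f := real hK (G.comp g) k)
    (g := (real hK' G k).comp (lmap g k)) (fun v => ?_) c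
  simp only [LinearMap.comp_apply, real_single, lmap_single]
  congr 1
  ext t
  simp [hg k v t]

/-- The tautological chain. -/
noncomputable def iot (k : ℕ) : LC (Simp k) k := Finsupp.single (vert k) 1

lemma real_iot (k : ℕ) (σ : Sing E k) : real (hSimp k) σ k (iot k) = Finsupp.single σ 1 := by
  rw [iot, real_single, aff_vert]; rfl

lemma lmap_iot (hK : Convex ℝ K) {k : ℕ} (v : Fin (k + 1) → K) :
    lmap (aff hK v) k (iot k) = Finsupp.single v 1 := by
  rw [iot, lmap_single, aff_comp_vert]

lemma sbd_sbd (k : ℕ) (c : SC E (k + 2)) : sbd E k (sbd E (k + 1) c) = 0 := by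
  refine hom_ext1 (f := (sbd E k).comp (sbd E (k + 1))) (g := 0) (fun σ => ?_) c
  simp [← real_iot, sbd_real, lbd_lbd]

/-- Subdivision of singular chains. -/
noncomputable def ssd (E : Type*) [TopologicalSpace E] (k : ℕ) : SC E k →ₗ[ℤ] SC E k :=
  Finsupp.linearCombination ℤ fun σ => real (hSimp k) σ k (lsd (bary (hSimp k)) k (iot k))

lemma ssd_single (k : ℕ) (σ : Sing E k) : ssd E k (Finsupp.single σ 1) =
    real (hSimp k) σ k (lsd (bary (hSimp k)) k (iot k)) := by
  simp [ssd]

lemma bary_nat (hK : Convex ℝ K) (hK' : Convex ℝ K') (g : K → K') (hg : IsAff hK hK' g)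
    (k : ℕ) (v : Fin (k + 1) → K) : g (bary hK k v) = bary hK' k (g ∘ v) := hg k v _

lemma ssd_real (p : ℕ) (σ : Sing E p) (k : ℕ) (c : LC (Simp p) k) :
    ssd E k (real (hSimp p) σ k c) = real (hSimp p) σ k (lsd (bary (hSimp p)) k c) := by
  refine hom_ext1 (f := (ssd E k).comp (real (hSimp p) σ k))
    (g := (real (hSimp p) σ k).comp (lsd (bary (hSimp p)) k)) (fun v => ?_) c
  simp only [LinearMap.comp_apply, real_single, ssd_single]
  rw [real_comp (hSimp k) (hSimp p) σ _ (isAff_aff _ v),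
    lmap_lsd _ (bary (hSimp p)) _ (bary_nat _ _ _ (isAff_aff _ v)), lmap_iot]

lemma sbd_ssd (k : ℕ) (c : SC E (k + 1)) : sbd E k (ssd E (k + 1) c) = ssd E k (sbd E k c) := by
  refine hom_ext1 (f := (sbd E k).comp (ssd E (k + 1))) (g := (ssd E k).comp (sbd E k))
    (fun σ => ?_) c
  simp only [LinearMap.comp_apply]
  rw [← real_iot, ssd_real, sbd_real, sbd_real, ssd_real, lbd_lsd]

/-- The tuple-level homotopy from the subdivision to the identity. -/
noncomputable def lT (k p : ℕ) : LC (Simp p) k →ₗ[ℤ] LC (Simp p) (k + 1) :=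
  lhom (bary (hSimp p)) (fun _ => LinearMap.id) (lsd (bary (hSimp p))) k

/-- The homotopy from subdivision to the identity. -/
noncomputable def sT (E : Type*) [TopologicalSpace E] (k : ℕ) : SC E k →ₗ[ℤ] SC E (k + 1) :=
  Finsupp.linearCombination ℤ fun σ => real (hSimp k) σ (k + 1) (lT k k (iot k))

lemma sT_single (k : ℕ) (σ : Sing E k) : sT E k (Finsupp.single σ 1) =
    real (hSimp k) σ (k + 1) (lT k k (iot k)) := by
  simp [sT]

lemma sT_real (p : ℕ) (σ : Sing E p) (k : ℕ) (c : LC (Simp p) k) :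
    sT E k (real (hSimp p) σ k c) = real (hSimp p) σ (k + 1) (lT k p c) := by
  refine hom_ext1 (f := (sT E k).comp (real (hSimp p) σ k))
    (g := (real (hSimp p) σ (k + 1)).comp (lT k p)) (fun v => ?_) c
  simp only [LinearMap.comp_apply, real_single, sT_single]
  rw [real_comp (hSimp k) (hSimp p) σ _ (isAff_aff _ v), lT,
    lmap_lhom _ _ _ (bary (hSimp p)) (fun _ => LinearMap.id) (lsd (bary (hSimp p)))
      (aff (hSimp p) v) (aff (hSimp p) v) (bary_nat _ _ _ (isAff_aff _ v)) (by simp)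
      (lmap_lsd _ _ _ (bary_nat _ _ _ (isAff_aff _ v))), lmap_iot, lT]

lemma sbd_sT (k : ℕ) (c : SC E (k + 1)) :
    sbd E (k + 1) (sT E (k + 1) c) = c - ssd E (k + 1) c - sT E k (sbd E k c) := by
  refine hom_ext1 (f := (sbd E (k + 1)).comp (sT E (k + 1)))
    (g := LinearMap.id - ssd E (k + 1) - (sT E k).comp (sbd E k)) (fun σ => ?_) c
  simp only [LinearMap.comp_apply, LinearMap.sub_apply, LinearMap.id_apply]
  rw [← real_iot, sT_real, sbd_real, sbd_real, ssd_real, sT_real, lT, lbd_lhom, map_sub, map_sub]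
  · rfl
  · intro c; simp [lsd]
  · simp
  · intro k c; rw [lbd_lsd]

/-- The prism over a simplex. -/
abbrev PrSet (p : ℕ) : Set ((Fin (p + 1) → ℝ) × ℝ) := stdSimplex ℝ (Fin (p + 1)) ×ˢ Set.Icc 0 1

lemma hPr (p : ℕ) : Convex ℝ (PrSet p) := (hSimp p).prod (convex_Icc 0 1)

/-- End inclusions of the prism. -/
def prInc (p : ℕ) (s : ℝ) (hs : s ∈ Set.Icc (0 : ℝ) 1) : C(Simp p, PrSet p) where
  toFun x := ⟨(x.1, s), x.2, hs⟩
  continuous_toFun := by fun_prop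

/-- The map of prisms. -/
def prMap {k p : ℕ} (g : C(Simp k, Simp p)) : C(PrSet k, PrSet p) where
  toFun x := ⟨((g ⟨x.1.1, x.2.1⟩).1, x.1.2), (g ⟨x.1.1, x.2.1⟩).2, x.2.2⟩
  continuous_toFun := by fun_prop

lemma isAff_prInc (p : ℕ) (s : ℝ) (hs : s ∈ Set.Icc (0 : ℝ) 1) :
    IsAff (hSimp p) (hPr p) (prInc p s hs) := by
  intro k v t
  apply Subtype.ext
  have h1 : ∑ i, t i = 1 := t.2.2
  simp only [prInc, ContinuousMap.coe_mk, aff_coe, Function.comp_apply, Prod.smul_mk]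
  rw [Prod.ext_iff]
  simp only [Prod.fst_sum, Prod.snd_sum, smul_eq_mul, ← Finset.sum_mul, h1, one_mul, and_self]

lemma isAff_prMap {k p : ℕ} (w : Fin (k + 1) → Simp p) :
    IsAff (hPr k) (hPr p) (prMap (aff (hSimp p) w)) := by
  intro q v t
  apply Subtype.ext
  have h := isAff_aff (hSimp p) w q (fun i => ⟨(v i).1.1, (v i).2.1⟩) t
  rw [Prod.ext_iff]
  constructor
  · have h' := congrArg Subtype.val h
    rw [aff_coe] at h'
    simp only [prMap, ContinuousMap.coe_mk, aff_coe, Function.comp_apply, Prod.smul_mk,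
      Prod.fst_sum] at h' ⊢
    rw [← h']
    rfl
  · simp [prMap, aff_coe, Prod.snd_sum]

/-- Tuple-level prism operator. -/
noncomputable def lP (k p : ℕ) : LC (Simp p) k →ₗ[ℤ] LC (PrSet p) (k + 1) :=
  lhom (fun _ v => prInc p 0 (by simp) (v 0)) (lmap (prInc p 1 (by simp)))
    (lmap (prInc p 0 (by simp))) k

/-- The prism map. -/
def prG (G : C(E × ℝ, E)) {p : ℕ} (σ : Sing E p) : C(PrSet p, E) where
  toFun x := G (σ ⟨x.1.1, x.2.1⟩, x.1.2)
  continuous_toFun := by fun_prop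

/-- The prism operator. -/
noncomputable def sP (G : C(E × ℝ, E)) (k : ℕ) : SC E k →ₗ[ℤ] SC E (k + 1) :=
  Finsupp.linearCombination ℤ fun σ => real (hPr k) (prG G σ) (k + 1) (lP k k (iot k))

lemma sP_single (G : C(E × ℝ, E)) (k : ℕ) (σ : Sing E k) : sP G k (Finsupp.single σ 1) =
    real (hPr k) (prG G σ) (k + 1) (lP k k (iot k)) := by
  simp [sP]

lemma lmap_lmap {X Y Z : Type*} (f : X → Y) (g : Y → Z) (k : ℕ) (c : LC X k) :
    lmap g k (lmap f k c) = lmap (g ∘ f) k c := by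
  refine hom_ext1 (f := (lmap g k).comp (lmap f k)) (g := lmap (g ∘ f) k) (fun v => ?_) c
  simp only [LinearMap.comp_apply, lmap_single, Function.comp_assoc]

lemma sP_real (G : C(E × ℝ, E)) (p : ℕ) (σ : Sing E p) (k : ℕ) (c : LC (Simp p) k) :
    sP G k (real (hSimp p) σ k c) = real (hPr p) (prG G σ) (k + 1) (lP k p c) := by
  refine hom_ext1 (f := (sP G k).comp (real (hSimp p) σ k))
    (g := (real (hPr p) (prG G σ) (k + 1)).comp (lP k p)) (fun v => ?_) c
  simp only [LinearMap.comp_apply, real_single, sP_single]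
  have : prG G (σ.comp (aff (hSimp p) v)) = (prG G σ).comp (prMap (aff (hSimp p) v)) := rfl
  rw [this, real_comp (hPr k) (hPr p) (prG G σ) _ (isAff_prMap v), lP, lP]
  rw [lmap_lhom _ _ _ (fun _ v => prInc p 0 (by simp) (v 0)) (lmap (prInc p 1 (by simp)))
    (lmap (prInc p 0 (by simp))) (aff (hSimp p) v) _ _ _ _, lmap_iot]
  · intro k v; rfl
  · intro k c; rw [lmap_lmap, lmap_lmap]; rfl
  · intro k c; rw [lmap_lmap, lmap_lmap]; rfl

/-- Pushforward of singular chains. -/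
noncomputable def push (f : C(E, E)) (k : ℕ) : SC E k →ₗ[ℤ] SC E k :=
  Finsupp.linearCombination ℤ fun σ => Finsupp.single (f.comp σ) (1 : ℤ)

lemma push_single (f : C(E, E)) (k : ℕ) (σ : Sing E k) :
    push f k (Finsupp.single σ 1) = Finsupp.single (f.comp σ) 1 := by
  simp [push]

lemma sbd_push (f : C(E, E)) (k : ℕ) (c : SC E (k + 1)) :
    sbd E k (push f (k + 1) c) = push f k (sbd E k c) := by
  refine hom_ext1 (f := (sbd E k).comp (push f (k + 1))) (g := (push f k).comp (sbd E k))
    (fun σ => ?_) c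
  simp only [LinearMap.comp_apply, push_single, sbd_single, map_sum, map_smul,
    ContinuousMap.comp_assoc]

/-- Slices of a homotopy. -/
def slice (G : C(E × ℝ, E)) (s : ℝ) : C(E, E) := ⟨fun x => G (x, s), by fun_prop⟩

lemma real_prInc (G : C(E × ℝ, E)) {p : ℕ} (σ : Sing E p) (s : ℝ) (hs : s ∈ Set.Icc (0 : ℝ) 1)
    (k : ℕ) (c : LC (Simp p) k) :
    real (hPr p) (prG G σ) k (lmap (prInc p s hs) k c) =
      push (slice G s) k (real (hSimp p) σ k c) := by
  rw [← real_comp (hSimp p) (hPr p) _ _ (isAff_prInc p s hs)]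
  refine hom_ext1 (f := real (hSimp p) ((prG G σ).comp (prInc p s hs)) k)
    (g := (push (slice G s) k).comp (real (hSimp p) σ k)) (fun v => ?_) c
  simp only [LinearMap.comp_apply, real_single, push_single]
  rfl

lemma sbd_sP_zero (G : C(E × ℝ, E)) (c : SC E 0) :
    sbd E 0 (sP G 0 c) = push (slice G 1) 0 c - push (slice G 0) 0 c := by
  refine hom_ext1 (f := (sbd E 0).comp (sP G 0))
    (g := push (slice G 1) 0 - push (slice G 0) 0) (fun σ => ?_) c
  simp only [LinearMap.comp_apply, LinearMap.sub_apply]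
  rw [← real_iot, sP_real, sbd_real, lP, lbd_lhom_zero, map_sub, real_prInc, real_prInc]
  intro c; rw [aug_lmap, aug_lmap]

lemma sbd_sP (G : C(E × ℝ, E)) (k : ℕ) (c : SC E (k + 1)) :
    sbd E (k + 1) (sP G (k + 1) c) =
      push (slice G 1) (k + 1) c - push (slice G 0) (k + 1) c - sP G k (sbd E k c) := by
  refine hom_ext1 (f := (sbd E (k + 1)).comp (sP G (k + 1)))
    (g := push (slice G 1) (k + 1) - push (slice G 0) (k + 1) - (sP G k).comp (sbd E k))
    (fun σ => ?_) c
  simp only [LinearMap.comp_apply, LinearMap.sub_apply]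
  rw [← real_iot, sP_real, sbd_real, lP, lbd_lhom, map_sub, map_sub, real_prInc, real_prInc,
    sbd_real, sP_real, lP]
  · intro c; rw [aug_lmap, aug_lmap]
  · intro k c; rw [lbd_lmap]
  · intro k c; rw [lbd_lmap]

/-- Chains supported in `U`. -/
noncomputable def sup (k : ℕ) (U : Set E) : Submodule ℤ (SC E k) :=
  Finsupp.supported ℤ ℤ {σ : Sing E k | ∀ t, σ t ∈ U}

lemma single_mem_sup {k : ℕ} {U : Set E} {σ : Sing E k} (h : ∀ t, σ t ∈ U) :
    Finsupp.single σ (1 : ℤ) ∈ sup k U := Finsupp.single_mem_supported ℤ 1 h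

lemma sup_mono {k : ℕ} {U V : Set E} (h : U ⊆ V) : sup k U ≤ sup k V :=
  Finsupp.supported_mono fun _ hσ t => h (hσ t)

/-- A linear map respects supports if it does so on generators. -/
lemma map_sup_of {k : ℕ} {U : Set E} {M : Type*} [AddCommGroup M] (f : SC E k →ₗ[ℤ] M)
    (S : Submodule ℤ M) (h : ∀ σ : Sing E k, (∀ t, σ t ∈ U) → f (Finsupp.single σ 1) ∈ S)
    {c : SC E k} (hc : c ∈ sup k U) : f c ∈ S := by
  have : sup k U ≤ S.comap f := by
    rw [sup, Finsupp.supported_eq_span_single, Submodule.span_le]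
    rintro _ ⟨σ, hσ, rfl⟩
    exact h σ hσ
  exact this hc

lemma real_mem_sup (hK : Convex ℝ K) (G : C(K, E)) (k : ℕ) {U : Set E} (h : ∀ x, G x ∈ U)
    (c : LC K k) : real hK G k c ∈ sup k U := by
  induction c using Finsupp.induction_linear with
  | zero => simp
  | add f g hf hg => rw [map_add]; exact add_mem hf hg
  | single v a =>
    have : (Finsupp.single v a : LC K k) = a • Finsupp.single v 1 := by simp
    rw [this, map_smul, real_single]
    exact Submodule.smul_mem _ _ (single_mem_sup fun t => h _)

lemma sbd_mem_sup {k : ℕ} {U : Set E} {c : SC E (k + 1)} (hc : c ∈ sup (k + 1) U) :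
    sbd E k c ∈ sup k U := by
  refine map_sup_of _ _ (fun σ hσ => ?_) hc
  rw [← real_iot, sbd_real]
  exact real_mem_sup _ _ _ hσ _

lemma ssd_mem_sup {k : ℕ} {U : Set E} {c : SC E k} (hc : c ∈ sup k U) :
    ssd E k c ∈ sup k U := by
  refine map_sup_of _ _ (fun σ hσ => ?_) hc
  rw [ssd_single]
  exact real_mem_sup _ _ _ hσ _

lemma sT_mem_sup {k : ℕ} {U : Set E} {c : SC E k} (hc : c ∈ sup k U) :
    sT E k c ∈ sup (k + 1) U := by
  refine map_sup_of _ _ (fun σ hσ => ?_) hc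
  rw [sT_single]
  exact real_mem_sup _ _ _ hσ _

lemma sP_mem_sup (G : C(E × ℝ, E)) {k : ℕ} {U V : Set E}
    (hG : ∀ x ∈ U, ∀ t ∈ Set.Icc (0 : ℝ) 1, G (x, t) ∈ V) {c : SC E k} (hc : c ∈ sup k U) :
    sP G k c ∈ sup (k + 1) V := by
  refine map_sup_of _ _ (fun σ hσ => ?_) hc
  rw [sP_single]
  exact real_mem_sup _ _ _ (fun x => hG _ (hσ _) _ x.2.2) _

lemma push_mem_sup (f : C(E, E)) {k : ℕ} {U V : Set E} (hf : ∀ x ∈ U, f x ∈ V) {c : SC E k}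
    (hc : c ∈ sup k U) : push f k c ∈ sup k V := by
  refine map_sup_of _ _ (fun σ hσ => ?_) hc
  rw [push_single]
  exact single_mem_sup fun t => hf _ (hσ t)

/-- Cycles in `U`. -/
noncomputable def Zc : (k : ℕ) → (U : Set E) → Submodule ℤ (SC E k)
  | 0, U => sup 0 U
  | k + 1, U => sup (k + 1) U ⊓ LinearMap.ker (sbd E k)

/-- Boundaries in `U`. -/
noncomputable def Bc (k : ℕ) (U : Set E) : Submodule ℤ (SC E k) :=
  (sup (k + 1) U).map (sbd E k)

lemma Zc_le (k : ℕ) (U : Set E) : Zc k U ≤ sup k U := by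
  cases k with
  | zero => exact le_rfl
  | succ k => exact inf_le_left

lemma Bc_le (k : ℕ) (U : Set E) : Bc k U ≤ Zc k U := by
  rintro _ ⟨c, hc, rfl⟩
  cases k with
  | zero => exact sbd_mem_sup hc
  | succ k => exact ⟨sbd_mem_sup hc, sbd_sbd k c⟩

lemma Bc_mono {k : ℕ} {U V : Set E} (h : U ⊆ V) : Bc k U ≤ Bc k V :=
  Submodule.map_mono (sup_mono h)

lemma Zc_mono {k : ℕ} {U V : Set E} (h : U ⊆ V) : Zc k U ≤ Zc k V := by
  cases k with
  | zero => exact sup_mono h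
  | succ k => exact inf_le_inf_right _ (sup_mono h)

lemma push_mem_Zc (f : C(E, E)) {k : ℕ} {U V : Set E} (hf : ∀ x ∈ U, f x ∈ V) {c : SC E k}
    (hc : c ∈ Zc k U) : push f k c ∈ Zc k V := by
  cases k with
  | zero => exact push_mem_sup f hf hc
  | succ k =>
    refine ⟨push_mem_sup f hf hc.1, ?_⟩
    have h2 : sbd E k c = 0 := hc.2
    simp [LinearMap.mem_ker, sbd_push, h2]

lemma push_mem_Bc (f : C(E, E)) {k : ℕ} {U V : Set E} (hf : ∀ x ∈ U, f x ∈ V) {c : SC E k}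
    (hc : c ∈ Bc k U) : push f k c ∈ Bc k V := by
  obtain ⟨d, hd, rfl⟩ := hc
  exact ⟨push f (k + 1) d, push_mem_sup f hf hd, sbd_push f k d⟩

/-- Homotopy invariance. -/
lemma homotopy (G : C(E × ℝ, E)) {k : ℕ} {U V : Set E}
    (hG : ∀ x ∈ U, ∀ t ∈ Set.Icc (0 : ℝ) 1, G (x, t) ∈ V) {c : SC E k} (hc : c ∈ Zc k U) :
    push (slice G 1) k c - push (slice G 0) k c ∈ Bc k V := by
  refine ⟨sP G k c, sP_mem_sup G hG (Zc_le k U hc), ?_⟩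
  cases k with
  | zero => exact sbd_sP_zero G c
  | succ k =>
    have h2 : sbd E k c = 0 := hc.2
    rw [sbd_sP, h2]; simp

end Aff

end TypeD

namespace TypeD

section Small
variable {W : Type*} [NormedAddCommGroup W] [NormedSpace ℝ W] {K : Set W}

lemma bary_coe (hK : Convex ℝ K) (k : ℕ) (v : Fin (k + 1) → K) :
    (bary hK k v : W) = ∑ i, ((k : ℝ) + 1)⁻¹ • (v i : W) := by
  rw [bary, aff_coe]
  refine Finset.sum_congr rfl fun i _ => ?_
  congr 1
  simp [stdSimplex.barycenter]
  rfl

lemma dist_aff_le (hK : Convex ℝ K) {k : ℕ} (v : Fin (k + 1) → K) (x : K) (R : ℝ)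
    (h : ∀ j, dist x (v j) ≤ R) (t : Simp k) : dist x (aff hK v t) ≤ R := by
  have h1 : Convex ℝ (Metric.closedBall (x : W) R) := convex_closedBall _ _
  have : (aff hK v t : W) ∈ Metric.closedBall (x : W) R := by
    rw [aff_coe]
    refine h1.sum_mem (fun i _ => t.2.1 i) t.2.2 (fun i _ => ?_)
    rw [Metric.mem_closedBall, dist_comm]
    exact h i
  rw [Metric.mem_closedBall, dist_comm] at this
  exact this

lemma dist_bary_le (hK : Convex ℝ K) (k : ℕ) (v : Fin (k + 1) → K) (D : ℝ)
    (h : ∀ i j, dist (v i) (v j) ≤ D) (j : Fin (k + 1)) :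
    dist (bary hK k v) (v j) ≤ (k : ℝ) / (k + 1) * D := by
  rw [Subtype.dist_eq, dist_eq_norm, bary_coe]
  have hk : (0 : ℝ) < (k : ℝ) + 1 := by positivity
  have h2 : ∑ i, ((k : ℝ) + 1)⁻¹ • (v i : W) - (v j : W)
      = ∑ i ∈ Finset.univ.erase j, ((k : ℝ) + 1)⁻¹ • ((v i : W) - v j) := by
    rw [Finset.sum_erase _ (by simp)]
    simp only [smul_sub, Finset.sum_sub_distrib]
    simp only [Finset.sum_const, Finset.card_univ, Fintype.card_fin]
    congr 1
    rw [← Nat.cast_smul_eq_nsmul ℝ, smul_smul]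
    push_cast
    rw [mul_inv_cancel₀ hk.ne', one_smul]
  rw [h2]
  refine (norm_sum_le _ _).trans ?_
  refine (Finset.sum_le_card_nsmul _ _ (((k : ℝ) + 1)⁻¹ * D) fun i _ => ?_).trans ?_
  · rw [norm_smul, norm_inv, Real.norm_of_nonneg hk.le]
    gcongr
    rw [← dist_eq_norm]; exact h i j
  · rw [Finset.card_erase_of_mem (Finset.mem_univ _), nsmul_eq_mul]
    simp
    rw [div_eq_mul_inv, mul_assoc]

/-- Tuples of small diameter near a given tuple. -/
def meshSet {k : ℕ} (D : ℝ) {q : ℕ} (v : Fin (q + 1) → K) : Set (Fin (k + 1) → K) :=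
  {w | (∀ i j, dist (w i) (w j) ≤ D) ∧
    ∀ (x : K) (R : ℝ), (∀ j, dist x (v j) ≤ R) → ∀ i, dist x (w i) ≤ R}

lemma map_supp {X M : Type*} [AddCommGroup M] (f : (X →₀ ℤ) →ₗ[ℤ] M)
    (S : Submodule ℤ M) (P : Set X) (h : ∀ x ∈ P, f (Finsupp.single x 1) ∈ S)
    {c : X →₀ ℤ} (hc : c ∈ Finsupp.supported ℤ ℤ P) : f c ∈ S := by
  have : Finsupp.supported ℤ ℤ P ≤ S.comap f := by
    rw [Finsupp.supported_eq_span_single, Submodule.span_le]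
    rintro _ ⟨σ, hσ, rfl⟩
    exact h σ hσ
  exact this hc

lemma lsd_mesh (hK : Convex ℝ K) (k : ℕ) (v : Fin (k + 1) → K) (D : ℝ) (hD : 0 ≤ D)
    (h : ∀ i j, dist (v i) (v j) ≤ D) :
    lsd (bary hK) k (Finsupp.single v 1) ∈
      Finsupp.supported ℤ ℤ (meshSet (k := k) ((k : ℝ) / (k + 1) * D) v) := by
  induction k with
  | zero =>
    simp only [lsd, LinearMap.id_apply]
    refine Finsupp.single_mem_supported ℤ 1 ⟨fun i j => ?_, fun x R hx => hx⟩
    have : i = j := Fin.ext (by omega)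
    rw [this]; simp
  | succ k ih =>
    rw [lsd_single, lbd_single, map_sum, map_sum]
    refine Submodule.sum_mem _ fun i _ => ?_
    rw [map_smul, map_smul]
    refine Submodule.smul_mem _ _ ?_
    refine map_supp (cone (bary hK (k + 1) v) k) _ _ ?_
      (ih (v ∘ i.succAbove) (fun _ _ => h _ _))
    intro w hw
    rw [cone_single]
    have hb := dist_bary_le hK (k + 1) v D h
    have hbw : ∀ j, dist (bary hK (k + 1) v) (w j) ≤ ((k + 1 : ℕ) : ℝ) / ((k + 1 : ℕ) + 1) * D :=
      hw.2 _ _ fun j => hb _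
    have hmono : (k : ℝ) / (k + 1) * D ≤ ((k + 1 : ℕ) : ℝ) / ((k + 1 : ℕ) + 1) * D := by
      refine mul_le_mul_of_nonneg_right ?_ hD
      rw [div_le_div_iff₀ (by positivity) (by positivity)]
      push_cast; nlinarith
    refine Finsupp.single_mem_supported ℤ 1 ⟨fun i j => ?_, fun x R hx j => ?_⟩
    · refine Fin.cases ?_ (fun i => ?_) i <;> refine Fin.cases ?_ (fun j => ?_) j
      · simp only [Fin.cons_zero, dist_self]; positivity
      · simpa using hbw j
      · rw [dist_comm]; simpa using hbw i
      · simpa using (hw.1 i j).trans hmono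
    · refine Fin.cases ?_ (fun j => ?_) j
      · simp only [Fin.cons_zero]
        exact dist_aff_le hK v x R hx _
      · simpa using hw.2 x R (fun j => hx _) j

lemma lsd_iter (hK : Convex ℝ K) (k : ℕ) (v : Fin (k + 1) → K) (D : ℝ) (hD : 0 ≤ D)
    (h : ∀ i j, dist (v i) (v j) ≤ D) (m : ℕ) :
    (lsd (bary hK) k)^[m] (Finsupp.single v 1) ∈
      Finsupp.supported ℤ ℤ
        {w : Fin (k + 1) → K | ∀ i j, dist (w i) (w j) ≤ ((k : ℝ) / (k + 1)) ^ m * D} := by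
  induction m with
  | zero => exact Finsupp.single_mem_supported ℤ 1 (by simpa using h)
  | succ m ih =>
    rw [Function.iterate_succ_apply']
    refine map_supp (lsd (bary hK) k) _ _ ?_ ih
    intro w hw
    have := lsd_mesh hK k w _ (by positivity) hw
    refine Finsupp.supported_mono ?_ this
    intro w' hw' i j
    rw [pow_succ', mul_assoc]
    exact hw'.1 i j

variable {E : Type*} [TopologicalSpace E] {J : Type*}

/-- Chains subordinate to a family of sets. -/
noncomputable def CS (k : ℕ) (V : J → Set E) : Submodule ℤ (SC E k) := ⨆ i, sup k (V i)

lemma sup_le_CS (k : ℕ) (V : J → Set E) (i : J) : sup k (V i) ≤ CS k V :=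
  le_iSup (fun i => sup k (V i)) i

lemma map_CS {k : ℕ} {V : J → Set E} {M : Type*} [AddCommGroup M] (f : SC E k →ₗ[ℤ] M)
    (S : Submodule ℤ M) (h : ∀ i, ∀ c ∈ sup k (V i), f c ∈ S) {c : SC E k} (hc : c ∈ CS k V) :
    f c ∈ S := by
  have : CS k V ≤ S.comap f := iSup_le fun i c hc => h i c hc
  exact this hc

lemma ssd_iter_real (p : ℕ) (σ : Sing E p) (k : ℕ) (c : LC (Simp p) k) (m : ℕ) :
    (ssd E k)^[m] (real (hSimp p) σ k c) =
      real (hSimp p) σ k ((lsd (bary (hSimp p)) k)^[m] c) := by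
  induction m with
  | zero => rfl
  | succ m ih => rw [Function.iterate_succ_apply', Function.iterate_succ_apply', ih, ssd_real]

lemma small_single {U : Set E} {V : J → Set E} (hV : ∀ i, IsOpen (V i)) (hU : U ⊆ ⋃ i, V i)
    (k : ℕ) (σ : Sing E k) (hσ : ∀ t, σ t ∈ U) :
    ∃ m₀, ∀ m ≥ m₀, (ssd E k)^[m] (Finsupp.single σ 1) ∈ CS k V := by
  obtain ⟨δ, hδ, hL⟩ := lebesgue_number_lemma_of_metric (s := (Set.univ : Set (Simp k)))
    (c := fun i => σ ⁻¹' (V i)) isCompact_univ (fun i => (hV i).preimage σ.continuous)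
    (fun t _ => by simpa using hU (hσ t))
  obtain ⟨D, hD⟩ : ∃ D, ∀ i j, dist (vert k i) (vert k j) ≤ D := by
    obtain ⟨D, hD⟩ := (Set.finite_range fun ij : Fin (k + 1) × Fin (k + 1) =>
      dist (vert k ij.1) (vert k ij.2)).bddAbove
    exact ⟨D, fun i j => hD ⟨(i, j), rfl⟩⟩
  have hD0 : 0 ≤ D := dist_nonneg.trans (hD 0 0)
  have hlim : Filter.Tendsto (fun m : ℕ => ((k : ℝ) / (k + 1)) ^ m * D) Filter.atTop
      (nhds (0 * D)) := by
    refine (tendsto_pow_atTop_nhds_zero_of_lt_one (by positivity) ?_).mul_const D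
    rw [div_lt_one (by positivity)]; linarith
  rw [zero_mul] at hlim
  obtain ⟨m₀, hm⟩ := Filter.eventually_atTop.1 (hlim.eventually (gt_mem_nhds hδ))
  refine ⟨m₀, fun m hmm => ?_⟩
  rw [← real_iot, ssd_iter_real]
  refine map_supp (real (hSimp k) σ k) _ _ ?_ (lsd_iter (hSimp k) k (vert k) D hD0 hD m)
  intro w hw
  rw [real_single]
  obtain ⟨i, hi⟩ := hL (w 0) trivial
  refine sup_le_CS k V i (single_mem_sup fun t => ?_)
  refine hi ?_
  rw [Metric.mem_ball, dist_comm]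
  exact (dist_aff_le (hSimp k) w (w 0) _ (hw 0) t).trans_lt (hm m hmm)

lemma ssd_iter_lin (k m : ℕ) : ∃ f : SC E k →ₗ[ℤ] SC E k, ∀ c, f c = (ssd E k)^[m] c :=
  ⟨(ssd E k) ^ m, fun c => by rw [Module.End.pow_apply]⟩

lemma small_chain {U : Set E} {V : J → Set E} (hV : ∀ i, IsOpen (V i)) (hU : U ⊆ ⋃ i, V i)
    (k : ℕ) (c : SC E k) (hc : c ∈ sup k U) :
    ∃ m, (ssd E k)^[m] c ∈ CS k V := by
  classical
  choose! f hf using small_single hV hU k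
  refine ⟨c.support.sup f, ?_⟩
  obtain ⟨g, hg⟩ := ssd_iter_lin (E := E) k (c.support.sup f)
  rw [← hg]
  have hc' : c ∈ Finsupp.supported ℤ ℤ (c.support : Set (Sing E k)) := by
    rw [Finsupp.mem_supported]
  refine map_supp g _ _ ?_ hc'
  intro σ hσ
  rw [hg]
  exact hf σ ((Finsupp.mem_supported ℤ c).1 hc hσ) _ (Finset.le_sup hσ)

lemma small {U : Set E} {V : J → Set E} (hV : ∀ i, IsOpen (V i)) (hU : U ⊆ ⋃ i, V i)
    (k : ℕ) (c : SC E (k + 1)) (hc : c ∈ sup (k + 1) U) (hb : sbd E k c ∈ CS k V) :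
    ∃ c' ∈ CS (k + 1) V, c - c' ∈ Bc (k + 1) U := by
  obtain ⟨m, hm⟩ := small_chain hV hU (k + 1) c hc
  induction m generalizing c with
  | zero => exact ⟨c, hm, by simp⟩
  | succ m ih =>
    obtain ⟨c₁, h1, h2⟩ := ih (ssd E (k + 1) c) (ssd_mem_sup hc)
      (by rw [sbd_ssd]
          exact map_CS _ _ (fun i c hc => sup_le_CS k V i (ssd_mem_sup hc)) hb) hm
    refine ⟨c₁ + sT E k (sbd E k c), add_mem h1
      (map_CS _ _ (fun i c hc => sup_le_CS (k + 1) V i (sT_mem_sup hc)) hb), ?_⟩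
    have : c - (c₁ + sT E k (sbd E k c)) =
        (ssd E (k + 1) c - c₁) + sbd E (k + 1) (sT E (k + 1) c) := by
      rw [sbd_sT]; abel
    rw [this]
    exact add_mem h2 ⟨_, sT_mem_sup hc, rfl⟩

end Small

end TypeD

namespace TypeD

section Geo
variable {n : ℕ}

/-- Signs. -/
def sgn (b : Bool) : ℝ := if b then 1 else -1

/-- Signed coordinates. -/
def val (α : Fin n × Bool) (x : Fin n → ℝ) : ℝ := sgn α.2 * x α.1

lemma abs_sgn (b : Bool) : |sgn b| = 1 := by cases b <;> simp [sgn]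

lemma sgn_sq (b : Bool) : sgn b * sgn b = 1 := by cases b <;> simp [sgn]

lemma abs_val (α : Fin n × Bool) (x : Fin n → ℝ) : |val α x| = |x α.1| := by
  rw [val, abs_mul, abs_sgn, one_mul]

lemma val_le (α : Fin n × Bool) (x : Fin n → ℝ) : val α x ≤ |x α.1| := by
  rw [← abs_val]; exact le_abs_self _

lemma abs_eq_val {α : Fin n × Bool} {x : Fin n → ℝ} (h : 0 < val α x) : |x α.1| = val α x := by
  rw [← abs_val, abs_of_pos h]

lemma exists_val (i : Fin n) (x : Fin n → ℝ) : ∃ b : Bool, val (i, b) x = |x i| := by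
  rcases le_total 0 (x i) with h | h
  · exact ⟨true, by simp [val, sgn, abs_of_nonneg h]⟩
  · exact ⟨false, by simp [val, sgn, abs_of_nonpos h]⟩

lemma val_pos_unique {α β : Fin n × Bool} {x : Fin n → ℝ} (h : α.1 = β.1) (ha : 0 < val α x)
    (hb : 0 < val β x) : α = β := by
  obtain ⟨i, a⟩ := α
  obtain ⟨j, b⟩ := β
  simp only at h
  subst h
  cases a <;> cases b <;> simp [val, sgn] at ha hb ⊢ <;> linarith

/-- The partial complement. -/
def M (T : Finset (Fin n)) : Set (Fin n → ℝ) :=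
  {x | ∀ i ∈ T, ∀ j ∈ T, ∀ l ∈ T, i ≠ j → j ≠ l → i ≠ l → |x i| = |x j| → |x j| = |x l| → False}

lemma M_congr {T : Finset (Fin n)} {x y : Fin n → ℝ} (hx : x ∈ M T) (h : ∀ k ∈ T, x k = y k) :
    y ∈ M T := by
  intro i hi j hj l hl
  rw [← h i hi, ← h j hj, ← h l hl]
  exact hx i hi j hj l hl

lemma M_anti {S T : Finset (Fin n)} (h : S ⊆ T) : (M T : Set (Fin n → ℝ)) ⊆ M S :=
  fun _ hx i hi j hj l hl => hx i (h hi) j (h hj) l (h hl)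

lemma M_of_two {T : Finset (Fin n)} {x : Fin n → ℝ} (p q : Fin n)
    (hx : x ∈ M ((T.erase p).erase q)) (hp : ∀ k ∈ (T.erase p).erase q, |x k| < |x p|)
    (hq : ∀ k ∈ (T.erase p).erase q, |x k| < |x q|) : x ∈ M T := by
  intro i hi j hj l hl hij hjl hil h1 h2
  have key : ∀ k ∈ T, k ≠ p → k ≠ q → k ∈ (T.erase p).erase q := fun k hk h h' =>
    Finset.mem_erase.2 ⟨h', Finset.mem_erase.2 ⟨h, hk⟩⟩
  have h3 := fun a b c => hx i a j b l c hij hjl hil h1 h2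
  grind

lemma M_of_card {T : Finset (Fin n)} (h : T.card ≤ 2) : M T = (Set.univ : Set (Fin n → ℝ)) := by
  ext x
  simp only [Set.mem_univ, iff_true]
  intro i hi j hj l hl hij hjl hil _ _
  have : ({i, j, l} : Finset (Fin n)).card = 3 := Finset.card_eq_three.2 ⟨i, j, l, hij, hil, hjl, rfl⟩
  have h2 := Finset.card_le_card (s := {i, j, l}) (t := T) (by
    intro k; simp only [Finset.mem_insert, Finset.mem_singleton]; rintro (rfl | rfl | rfl) <;> assumption)
  omega

lemma isOpen_M (T : Finset (Fin n)) : IsOpen (M T : Set (Fin n → ℝ)) := by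
  have : (M T : Set (Fin n → ℝ)) = ⋂ i ∈ T, ⋂ j ∈ T, ⋂ l ∈ T, ⋂ (_ : i ≠ j ∧ j ≠ l ∧ i ≠ l),
      {x : Fin n → ℝ | |x i| = |x j| ∧ |x j| = |x l|}ᶜ := by
    ext x
    simp only [M, Set.mem_ofPred_eq, Set.mem_iInter, Set.mem_compl_iff]
    constructor
    · intro h i hi j hj l hl hh h2
      exact h i hi j hj l hl hh.1 hh.2.1 hh.2.2 h2.1 h2.2
    · intro h i hi j hj l hl h1 h2 h3 h4 h5
      exact h i hi j hj l hl ⟨h1, h2, h3⟩ ⟨h4, h5⟩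
  rw [this]
  refine isOpen_biInter_finset fun i _ => isOpen_biInter_finset fun j _ =>
    isOpen_biInter_finset fun l _ => isOpen_iInter_of_finite fun _ => ?_
  rw [isOpen_compl_iff]
  exact (isClosed_eq (by fun_prop) (by fun_prop)).inter (isClosed_eq (by fun_prop) (by fun_prop))

/-- One dominating letter. -/
def rA (N : Finset (Fin n)) (α : Fin n × Bool) : Set (Fin n → ℝ) :=
  {x | α.1 ∈ N ∧ x ∈ M (N.erase α.1) ∧ 0 < val α x ∧ ∀ k ∈ N.erase α.1, |x k| < val α x}

/-- Two dominating letters. -/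
def rB (N : Finset (Fin n)) (α β : Fin n × Bool) : Set (Fin n → ℝ) :=
  {x | α.1 < β.1 ∧ α.1 ∈ N ∧ β.1 ∈ N ∧ x ∈ M ((N.erase α.1).erase β.1) ∧
    0 < val α x ∧ 0 < val β x ∧
    (∀ k ∈ (N.erase α.1).erase β.1, |x k| < val α x) ∧
    ∀ k ∈ (N.erase α.1).erase β.1, |x k| < val β x}

/-- Two ordered dominating letters. -/
def rR (N : Finset (Fin n)) (α β : Fin n × Bool) : Set (Fin n → ℝ) :=
  {x | α.1 ≠ β.1 ∧ α.1 ∈ N ∧ β.1 ∈ N ∧ x ∈ M ((N.erase α.1).erase β.1) ∧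
    0 < val β x ∧ val β x < val α x ∧
    ∀ k ∈ (N.erase α.1).erase β.1, |x k| < val β x}

lemma continuous_val (α : Fin n × Bool) : Continuous (val α) := by
  unfold val; fun_prop

lemma isOpen_rA (N : Finset (Fin n)) (α : Fin n × Bool) : IsOpen (rA N α) := by
  have h := continuous_val α
  have : rA N α = {x | α.1 ∈ N} ∩ (M (N.erase α.1) ∩ ({x | 0 < val α x} ∩
      ⋂ k ∈ N.erase α.1, {x | |x k| < val α x})) := by
    ext x
    simp only [rA, Set.mem_ofPred_eq, Set.mem_inter_iff, Set.mem_iInter]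
  rw [this]
  refine isOpen_const.inter ((isOpen_M _).inter ((isOpen_lt continuous_const h).inter ?_))
  exact isOpen_biInter_finset fun k _ => isOpen_lt (by fun_prop) h

lemma isOpen_rB (N : Finset (Fin n)) (α β : Fin n × Bool) : IsOpen (rB N α β) := by
  have h := continuous_val α
  have h' := continuous_val β
  have : rB N α β = {x | α.1 < β.1} ∩ ({x | α.1 ∈ N} ∩ ({x | β.1 ∈ N} ∩
      (M ((N.erase α.1).erase β.1) ∩ ({x | 0 < val α x} ∩ ({x | 0 < val β x} ∩
      ((⋂ k ∈ (N.erase α.1).erase β.1, {x | |x k| < val α x}) ∩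
      ⋂ k ∈ (N.erase α.1).erase β.1, {x | |x k| < val β x})))))) := by
    ext x
    simp only [rB, Set.mem_ofPred_eq, Set.mem_inter_iff, Set.mem_iInter]
  rw [this]
  refine isOpen_const.inter (isOpen_const.inter (isOpen_const.inter ((isOpen_M _).inter
    ((isOpen_lt continuous_const h).inter ((isOpen_lt continuous_const h').inter
      (IsOpen.inter ?_ ?_))))))
  · exact isOpen_biInter_finset fun k _ => isOpen_lt (by fun_prop) h
  · exact isOpen_biInter_finset fun k _ => isOpen_lt (by fun_prop) h'

lemma rA_sub (N : Finset (Fin n)) (α : Fin n × Bool) : rA N α ⊆ M N := by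
  rintro x ⟨_, h1, h2, h3⟩
  refine M_of_two α.1 α.1 ?_ ?_ ?_
  · exact M_anti (Finset.erase_subset _ _) h1
  all_goals
  · intro k hk
    rw [abs_eq_val h2]
    exact h3 k (Finset.mem_of_mem_erase hk)

lemma rB_sub (N : Finset (Fin n)) (α β : Fin n × Bool) : rB N α β ⊆ M N := by
  rintro x ⟨_, _, _, h1, h2, h2', h3, h4⟩
  refine M_of_two α.1 β.1 h1 ?_ ?_
  · rw [abs_eq_val h2]; exact h3
  · rw [abs_eq_val h2']; exact h4

lemma rR_sub_rA (N : Finset (Fin n)) (α β : Fin n × Bool) : rR N α β ⊆ rA N α := by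
  rintro x ⟨h0, hα, hβ, h1, h2, h3, h4⟩
  refine ⟨hα, ?_, h2.trans h3, ?_⟩
  · refine M_of_two β.1 β.1 (M_anti (Finset.erase_subset _ _) h1) ?_ ?_
    all_goals
    · intro k hk
      rw [abs_eq_val h2]
      exact h4 k (Finset.mem_of_mem_erase hk)
  · intro k hk
    by_cases hkb : k = β.1
    · rw [hkb, abs_eq_val h2]; exact h3
    · exact (h4 k (Finset.mem_erase.2 ⟨hkb, hk⟩)).trans h3

lemma rA_inter_rB (N : Finset (Fin n)) (α β : Fin n × Bool) : rA N α ∩ rB N α β ⊆ rR N α β := by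
  rintro x ⟨⟨_, _, _, h⟩, ⟨h0, hα, hβ, h1, h2, h2', h3, h4⟩⟩
  refine ⟨h0.ne, hα, hβ, h1, h2', ?_, h4⟩
  rw [← abs_eq_val h2']
  exact h _ (Finset.mem_erase.2 ⟨h0.ne', hβ⟩)

lemma rA_inter_rB' (N : Finset (Fin n)) (α β : Fin n × Bool) : rA N α ∩ rB N β α ⊆ rR N α β := by
  rintro x ⟨⟨_, _, _, h⟩, ⟨h0, hβ, hα, h1, h2, h2', h3, h4⟩⟩
  rw [Finset.erase_right_comm] at h1 h3
  refine ⟨h0.ne', hα, hβ, h1, h2, ?_, h3⟩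
  rw [← abs_eq_val h2]
  exact h _ (Finset.mem_erase.2 ⟨h0.ne, hβ⟩)

lemma rR_sub_rB (N : Finset (Fin n)) (α β : Fin n × Bool) (hlt : α.1 < β.1) :
    rR N α β ⊆ rB N α β := by
  rintro x ⟨h0, hα, hβ, h1, h2, h3, h4⟩
  exact ⟨hlt, hα, hβ, h1, h2.trans h3, h2, fun k hk => (h4 k hk).trans h3, h4⟩

lemma rR_sub_rB' (N : Finset (Fin n)) (α β : Fin n × Bool) (hlt : β.1 < α.1) :
    rR N α β ⊆ rB N β α := by
  rintro x ⟨h0, hα, hβ, h1, h2, h3, h4⟩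
  have h5 := fun k hk => (h4 k hk).trans h3
  rw [Finset.erase_right_comm] at h1
  rw [Finset.erase_right_comm] at h4
  rw [Finset.erase_right_comm] at h5
  exact ⟨hlt, hβ, hα, h1, h2, h2.trans h3, h4, h5⟩

lemma rA_disj (N : Finset (Fin n)) {α β : Fin n × Bool} {x : Fin n → ℝ} (h1 : x ∈ rA N α)
    (h2 : x ∈ rA N β) : α = β := by
  obtain ⟨ha, _, hb, hc⟩ := h1
  obtain ⟨ha', _, hb', hc'⟩ := h2
  by_cases h : α.1 = β.1
  · exact val_pos_unique h hb hb'
  · have e1 := hc _ (Finset.mem_erase.2 ⟨Ne.symm h, ha'⟩)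
    have e2 := hc' _ (Finset.mem_erase.2 ⟨h, ha⟩)
    rw [abs_eq_val hb] at e2
    rw [abs_eq_val hb'] at e1
    linarith

lemma rB_disj (N : Finset (Fin n)) {α β γ δ : Fin n × Bool} {x : Fin n → ℝ} (h1 : x ∈ rB N α β)
    (h2 : x ∈ rB N γ δ) : α = γ ∧ β = δ := by
  obtain ⟨hlt, ha, hb, _, pa, pb, da, db⟩ := h1
  obtain ⟨hlt', hc, hd, _, pc, pd, dc, dd⟩ := h2
  simp only [← abs_eq_val pa, ← abs_eq_val pb, ← abs_eq_val pc, ← abs_eq_val pd,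
    Finset.mem_erase] at da db dc dd
  have e1 : α.1 = γ.1 ∧ β.1 = δ.1 := by
    by_contra hcon
    have := da γ.1
    have := da δ.1
    have := db γ.1
    have := db δ.1
    have := dc α.1
    have := dc β.1
    have := dd α.1
    have := dd β.1
    clear da db dc dd
    grind
  exact ⟨val_pos_unique e1.1 pa pc, val_pos_unique e1.2 pb pd⟩

lemma rAB_disj (N : Finset (Fin n)) {α β γ : Fin n × Bool} {x : Fin n → ℝ} (h1 : x ∈ rA N γ)
    (h2 : x ∈ rB N α β) : γ = α ∨ γ = β := by
  obtain ⟨hc, _, pc, dc⟩ := h1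
  obtain ⟨hlt, ha, hb, _, pa, pb, da, db⟩ := h2
  by_cases e : γ.1 = α.1
  · exact Or.inl (val_pos_unique e pc pa)
  by_cases e' : γ.1 = β.1
  · exact Or.inr (val_pos_unique e' pc pb)
  have e1 := dc _ (Finset.mem_erase.2 ⟨Ne.symm e, ha⟩)
  have e2 := da γ.1 (Finset.mem_erase.2 ⟨e', Finset.mem_erase.2 ⟨e, hc⟩⟩)
  rw [abs_eq_val pa] at e1
  rw [abs_eq_val pc] at e2
  linarith

lemma rR_disj (N : Finset (Fin n)) {α β γ : Fin n × Bool} {x : Fin n → ℝ} (h1 : x ∈ rR N α β)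
    (h2 : x ∈ rR N α γ) : β = γ := by
  obtain ⟨ne, ha, hb, _, pb, _, db⟩ := h1
  obtain ⟨ne', _, hc, _, pc, _, dc⟩ := h2
  by_cases e : β.1 = γ.1
  · exact val_pos_unique e pb pc
  have e1 := db γ.1 (Finset.mem_erase.2 ⟨Ne.symm e, Finset.mem_erase.2 ⟨Ne.symm ne', hc⟩⟩)
  have e2 := dc β.1 (Finset.mem_erase.2 ⟨e, Finset.mem_erase.2 ⟨Ne.symm ne, hb⟩⟩)
  rw [abs_eq_val pc] at e1
  rw [abs_eq_val pb] at e2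
  linarith

lemma cover (N : Finset (Fin n)) (hN : 3 ≤ N.card) {x : Fin n → ℝ} (hx : x ∈ M N) :
    (∃ α, x ∈ rA N α) ∨ ∃ α β, x ∈ rB N α β := by
  obtain ⟨i, hi, hmax⟩ := N.exists_max_image (fun i => |x i|) (Finset.card_pos.1 (by omega))
  obtain ⟨a, ha⟩ := exists_val i x
  by_cases h : ∃ j ∈ N, j ≠ i ∧ |x j| = |x i|
  · right
    obtain ⟨j, hj, hji, hjx⟩ := h
    obtain ⟨b, hb⟩ := exists_val j x
    have hlt : ∀ k ∈ N, k ≠ i → k ≠ j → |x k| < |x i| := by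
      intro k hk hki hkj
      refine lt_of_le_of_ne (hmax k hk) fun e => ?_
      exact hx k hk i hi j hj hki (Ne.symm hji) hkj e hjx.symm
    obtain ⟨k, hk, hk'⟩ : ∃ k ∈ N, k ∉ ({i, j} : Finset (Fin n)) := by
      by_contra hcon
      push Not at hcon
      have := Finset.card_le_card (s := N) (t := {i, j}) hcon
      have := Finset.card_le_two (a := i) (b := j)
      omega
    simp only [Finset.mem_insert, Finset.mem_singleton, not_or] at hk'
    have pos : 0 < |x i| := (abs_nonneg _).trans_lt (hlt k hk hk'.1 hk'.2)
    have hlt' : ∀ k ∈ (N.erase i).erase j, |x k| < |x i| := by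
      intro k hk
      simp only [Finset.mem_erase] at hk
      exact hlt k hk.2.2 hk.2.1 hk.1
    have hM : x ∈ M ((N.erase i).erase j) :=
      M_anti ((Finset.erase_subset _ _).trans (Finset.erase_subset _ _)) hx
    rcases lt_or_gt_of_ne hji with hl | hl
    · refine ⟨(j, b), (i, a), hl, hj, hi, ?_, ?_, ?_, ?_, ?_⟩
      · simpa only [Finset.erase_right_comm] using hM
      · rw [hb, hjx]; exact pos
      · rw [ha]; exact pos
      · rw [hb, hjx, Finset.erase_right_comm]; exact hlt'
      · rw [ha, Finset.erase_right_comm]; exact hlt'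
    · refine ⟨(i, a), (j, b), hl, hi, hj, hM, ?_, ?_, ?_, ?_⟩
      · rw [ha]; exact pos
      · rw [hb, hjx]; exact pos
      · rw [ha]; exact hlt'
      · rw [hb, hjx]; exact hlt'
  · left
    push Not at h
    have hlt : ∀ k ∈ N.erase i, |x k| < |x i| := by
      intro k hk
      simp only [Finset.mem_erase] at hk
      exact lt_of_le_of_ne (hmax k hk.2) (h k hk.2 hk.1)
    obtain ⟨k, hk⟩ : (N.erase i).Nonempty := by
      rw [← Finset.card_pos, Finset.card_erase_of_mem hi]; omega
    refine ⟨(i, a), hi, M_anti (Finset.erase_subset _ _) hx, ?_, ?_⟩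
    · rw [ha]; exact (abs_nonneg _).trans_lt (hlt k hk)
    · rw [ha]; exact hlt

/-- A number exceeding all coordinates. -/
noncomputable def big (x : Fin n → ℝ) : ℝ := 1 + ∑ k, |x k|

lemma lt_big (x : Fin n → ℝ) (k : Fin n) : |x k| < big x := by
  have := Finset.single_le_sum (f := fun k => |x k|) (fun i _ => abs_nonneg _) (Finset.mem_univ k)
  unfold big; linarith

lemma big_pos (x : Fin n → ℝ) : 0 < big x := by
  unfold big; positivity

/-- Making a letter dominate. -/
noncomputable def uu (α : Fin n × Bool) : C(Fin n → ℝ, Fin n → ℝ) where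
  toFun x := Function.update x α.1 (sgn α.2 * big x)
  continuous_toFun := by
    refine Continuous.update continuous_id _ ?_
    unfold big; fun_prop

lemma uu_ne (α : Fin n × Bool) (x : Fin n → ℝ) {k : Fin n} (h : k ≠ α.1) : uu α x k = x k := by
  simp [uu, h]

lemma val_uu (α : Fin n × Bool) (x : Fin n → ℝ) : val α (uu α x) = big x := by
  simp [uu, val, ← mul_assoc, sgn_sq]

lemma val_uu_ne (α β : Fin n × Bool) (x : Fin n → ℝ) (h : β.1 ≠ α.1) :
    val β (uu α x) = val β x := by
  simp [val, uu_ne α x h]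

/-- Linear interpolation. -/
lemma val_line (α : Fin n × Bool) (x y : Fin n → ℝ) (t : ℝ) :
    val α ((1 - t) • x + t • y) = (1 - t) * val α x + t * val α y := by
  simp [val]; ring

lemma lt_line {a b c t : ℝ} (h : t ∈ Set.Icc (0 : ℝ) 1) (h1 : c < a) (h2 : c < b) :
    c < (1 - t) * a + t * b := by
  obtain ⟨h0, h3⟩ := h
  by_contra hcon
  push Not at hcon
  rcases eq_or_lt_of_le h0 with rfl | h0
  · linarith
  · have e1 := mul_lt_mul_of_pos_left h2 h0
    have e2 := mul_le_mul_of_nonneg_left h1.le (sub_nonneg.2 h3)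
    linarith

lemma line_lt_line {a b c d t : ℝ} (h : t ∈ Set.Icc (0 : ℝ) 1) (h1 : c < a) (h2 : d < b) :
    (1 - t) * c + t * d < (1 - t) * a + t * b := by
  have := lt_line (a := a - c) (b := b - d) (c := 0) h (by linarith) (by linarith)
  linarith

lemma line_eq {x y : Fin n → ℝ} {k : Fin n} (h : y k = x k) (t : ℝ) :
    ((1 - t) • x + t • y) k = x k := by
  simp [h]; ring

lemma uu_mem (α : Fin n × Bool) (T : Finset (Fin n)) {x : Fin n → ℝ} (hx : x ∈ M (T.erase α.1)) :
    uu α x ∈ M T := by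
  have h : ∀ k ∈ (T.erase α.1).erase α.1, |uu α x k| < |uu α x α.1| := by
    intro k hk
    rw [uu_ne α x (Finset.ne_of_mem_erase hk), abs_eq_val (by rw [val_uu]; exact big_pos x), val_uu]
    exact lt_big x k
  refine M_of_two α.1 α.1 ?_ h h
  refine M_congr (M_anti (Finset.erase_subset _ _) hx) fun k hk => ?_
  rw [uu_ne α x (Finset.ne_of_mem_erase hk)]

lemma lineA' (α : Fin n × Bool) (N : Finset (Fin n)) {x : Fin n → ℝ} (hx : x ∈ rA N α) {t : ℝ}
    (_ : t ∈ Set.Icc (0 : ℝ) 1) : (1 - t) • x + t • uu α x ∈ M (N.erase α.1) :=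
  M_congr hx.2.1 fun _ hk => (line_eq (uu_ne α x (Finset.ne_of_mem_erase hk)) t).symm

lemma lineA (α : Fin n × Bool) (N : Finset (Fin n)) {x : Fin n → ℝ} (hx : x ∈ rA N α) {t : ℝ}
    (ht : t ∈ Set.Icc (0 : ℝ) 1) : (1 - t) • x + t • uu α x ∈ M N := by
  refine rA_sub N α ⟨hx.1, lineA' α N hx ht, ?_, ?_⟩
  · rw [val_line, val_uu]
    exact lt_line ht hx.2.2.1 (big_pos x)
  · intro k hk
    rw [val_line, val_uu, line_eq (uu_ne α x (Finset.ne_of_mem_erase hk))]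
    exact lt_line ht (hx.2.2.2 k hk) (lt_big x k)

lemma rR_sub_rA' (N : Finset (Fin n)) (α β : Fin n × Bool) : rR N α β ⊆ rA (N.erase α.1) β := by
  rintro x ⟨h0, hα, hβ, h1, h2, h3, h4⟩
  exact ⟨Finset.mem_erase.2 ⟨h0.symm, hβ⟩, h1, h2, h4⟩

lemma uu_uu_eq (α β : Fin n × Bool) (x : Fin n → ℝ) {k : Fin n} (h1 : k ≠ α.1) (h2 : k ≠ β.1) :
    uu α (uu β x) k = x k := by
  rw [uu_ne _ _ h1, uu_ne _ _ h2]

lemma uu_uu_mem_rR (α β : Fin n × Bool) (N : Finset (Fin n)) (hα : α.1 ∈ N) (hβ : β.1 ∈ N)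
    (h : α.1 ≠ β.1) {x : Fin n → ℝ} (hx : x ∈ M ((N.erase α.1).erase β.1)) :
    uu α (uu β x) ∈ rR N α β := by
  have hk : ∀ k ∈ (N.erase α.1).erase β.1, uu α (uu β x) k = x k := by
    intro k hk
    simp only [Finset.mem_erase] at hk
    exact uu_uu_eq α β x hk.2.1 hk.1
  refine ⟨h, hα, hβ, M_congr hx fun k h => (hk k h).symm, ?_, ?_, ?_⟩
  · rw [val_uu_ne _ _ _ h.symm, val_uu]; exact big_pos x
  · rw [val_uu_ne _ _ _ h.symm, val_uu α]
    exact (val_le _ _).trans_lt (lt_big _ _)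
  · intro k hk'
    rw [val_uu_ne _ _ _ h.symm, val_uu, hk k hk']
    exact lt_big _ _

lemma lineR (α β : Fin n × Bool) (N : Finset (Fin n)) {x : Fin n → ℝ} (hx : x ∈ rR N α β) {t : ℝ}
    (ht : t ∈ Set.Icc (0 : ℝ) 1) : (1 - t) • x + t • uu α (uu β x) ∈ rR N α β := by
  have hy := uu_uu_mem_rR α β N hx.2.1 hx.2.2.1 hx.1 hx.2.2.2.1
  have hk : ∀ k ∈ (N.erase α.1).erase β.1, uu α (uu β x) k = x k := by
    intro k hk
    simp only [Finset.mem_erase] at hk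
    exact uu_uu_eq α β x hk.2.1 hk.1
  generalize uu α (uu β x) = y at *
  obtain ⟨h0, hα, hβ, h1, h2, h3, h4⟩ := hx
  obtain ⟨_, _, _, h1', h2', h3', h4'⟩ := hy
  refine ⟨h0, hα, hβ, M_congr h1 fun k h => (line_eq (hk k h) t).symm, ?_, ?_, ?_⟩
  · rw [val_line]; exact lt_line ht h2 h2'
  · rw [val_line, val_line]; exact line_lt_line ht h3 h3'
  · intro k h
    rw [val_line, line_eq (hk k h)]
    refine lt_line ht (h4 k h) ?_
    rw [← hk k h]; exact h4' k h

lemma uu_uu_val (α β : Fin n × Bool) (h : α.1 ≠ β.1) (x : Fin n → ℝ) (k : Fin n) :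
    (|x k| < val α (uu α (uu β x)) ∧ |x k| < val β (uu α (uu β x))) ∨ k = β.1 := by
  by_cases hk : k = β.1
  · exact Or.inr hk
  · left
    rw [val_uu_ne _ _ _ h.symm, val_uu, val_uu]
    refine ⟨?_, lt_big _ _⟩
    have := lt_big (uu β x) k
    rwa [uu_ne _ _ hk] at this

lemma lineB (α β : Fin n × Bool) (N : Finset (Fin n)) {x : Fin n → ℝ} (hx : x ∈ rB N α β) {t : ℝ}
    (ht : t ∈ Set.Icc (0 : ℝ) 1) : (1 - t) • x + t • uu α (uu β x) ∈ M N := by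
  obtain ⟨h0, hα, hβ, h1, h2, h2', h3, h4⟩ := hx
  have hy := uu_uu_mem_rR α β N hα hβ h0.ne h1
  have hy' := rR_sub_rB N α β h0 hy
  have hk : ∀ k ∈ (N.erase α.1).erase β.1, uu α (uu β x) k = x k := by
    intro k hk
    simp only [Finset.mem_erase] at hk
    exact uu_uu_eq α β x hk.2.1 hk.1
  generalize uu α (uu β x) = y at *
  obtain ⟨_, _, _, _, g2, g2', g3, g4⟩ := hy'
  refine rB_sub N α β ⟨h0, hα, hβ, M_congr h1 fun k h => (line_eq (hk k h) t).symm, ?_, ?_, ?_, ?_⟩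
  · rw [val_line]; exact lt_line ht h2 g2
  · rw [val_line]; exact lt_line ht h2' g2'
  · intro k h
    rw [val_line, line_eq (hk k h)]
    refine lt_line ht (h3 k h) ?_
    rw [← hk k h]; exact g3 k h
  · intro k h
    rw [val_line, line_eq (hk k h)]
    refine lt_line ht (h4 k h) ?_
    rw [← hk k h]; exact g4 k h

lemma lineC (α β : Fin n × Bool) (N : Finset (Fin n)) (hab : α.1 ≠ β.1)
    {x : Fin n → ℝ} (hx : x ∈ M ((N.erase α.1).erase β.1)) {t : ℝ}
    (ht : t ∈ Set.Icc (0 : ℝ) 1) : (1 - t) • uu α (uu β x) + t • uu β (uu α x) ∈ M N := by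
  have hka : ∀ k ∈ (N.erase α.1).erase β.1, uu α (uu β x) k = x k := by
    intro k hk
    simp only [Finset.mem_erase] at hk
    exact uu_uu_eq α β x hk.2.1 hk.1
  have hkb : ∀ k ∈ (N.erase α.1).erase β.1, uu β (uu α x) k = x k := by
    intro k hk
    simp only [Finset.mem_erase] at hk
    exact uu_uu_eq β α x hk.1 hk.2.1
  have hk : ∀ k ∈ (N.erase α.1).erase β.1,
      ((1 - t) • uu α (uu β x) + t • uu β (uu α x)) k = x k := by
    intro k h
    rw [line_eq ((hkb k h).trans (hka k h).symm), hka k h]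
  refine M_of_two α.1 β.1 (M_congr hx fun k h => (hk k h).symm) ?_ ?_
  all_goals
  · intro k h
    rw [hk k h]
    simp only [Finset.mem_erase] at h
    have e1 := (uu_uu_val α β hab x k).resolve_right h.1
    have e2 := (uu_uu_val β α hab.symm x k).resolve_right h.2.1
    refine lt_of_lt_of_le ?_ (val_le _ _)
    rw [val_line]
    first
    | exact lt_line ht e1.1 e2.2
    | exact lt_line ht e1.2 e2.1

end Geo

end TypeD

namespace TypeD

section Hom
variable {n : ℕ}

/-- Straight-line homotopies. -/
def lineH (f g : C(Fin n → ℝ, Fin n → ℝ)) : C((Fin n → ℝ) × ℝ, Fin n → ℝ) where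
  toFun x := (1 - x.2) • f x.1 + x.2 • g x.1
  continuous_toFun := by fun_prop

lemma homotopy_line (f g : C(Fin n → ℝ, Fin n → ℝ)) {k : ℕ} {U V : Set (Fin n → ℝ)}
    (h : ∀ x ∈ U, ∀ t ∈ Set.Icc (0 : ℝ) 1, (1 - t) • f x + t • g x ∈ V)
    {c : SC (Fin n → ℝ) k} (hc : c ∈ Zc k U) : push g k c - push f k c ∈ Bc k V := by
  have := homotopy (lineH f g) (V := V) h hc
  have e1 : slice (lineH f g) 1 = g := by ext x; simp [slice, lineH]
  have e0 : slice (lineH f g) 0 = f := by ext x; simp [slice, lineH]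
  rwa [e1, e0] at this

variable {E : Type*} [TopologicalSpace E]

lemma push_id (k : ℕ) (c : SC E k) : push (ContinuousMap.id E) k c = c := by
  refine hom_ext1 (f := push (ContinuousMap.id E) k) (g := LinearMap.id) (fun σ => ?_) c
  rw [push_single]; rfl

lemma push_comp (f g : C(E, E)) (k : ℕ) (c : SC E k) :
    push (f.comp g) k c = push f k (push g k c) := by
  refine hom_ext1 (f := push (f.comp g) k) (g := (push f k).comp (push g k)) (fun σ => ?_) c
  simp only [LinearMap.comp_apply, push_single]; rfl

lemma homotopy_id (g : C(Fin n → ℝ, Fin n → ℝ)) {k : ℕ} {U V : Set (Fin n → ℝ)}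
    (h : ∀ x ∈ U, ∀ t ∈ Set.Icc (0 : ℝ) 1, (1 - t) • x + t • g x ∈ V)
    {c : SC (Fin n → ℝ) k} (hc : c ∈ Zc k U) : push g k c - c ∈ Bc k V := by
  have := homotopy_line (ContinuousMap.id _) g (V := V) h hc
  rwa [push_id] at this

lemma sbd_const (k : ℕ) (e : E) :
    sbd E k (Finsupp.single (ContinuousMap.const _ e) 1) =
      (if Even (k + 2) then (0 : ℤ) else 1) • Finsupp.single (ContinuousMap.const _ e) 1 := by
  rw [sbd_single, ← Fin.sum_neg_one_pow ℤ (k + 2), Finset.sum_smul]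
  rfl

lemma push_const (k : ℕ) (e : E) (c : SC E k) :
    ∃ m : ℤ, push (ContinuousMap.const E e) k c = m • Finsupp.single (ContinuousMap.const _ e) 1 := by
  refine ⟨Finsupp.linearCombination ℤ (fun _ => (1 : ℤ)) c, ?_⟩
  refine hom_ext1 (f := push (ContinuousMap.const E e) k)
    (g := (Finsupp.linearCombination ℤ (fun _ => (1 : ℤ))).smulRight
      (Finsupp.single (ContinuousMap.const _ e) 1)) (fun σ => ?_) c
  rw [push_single]; simp

lemma contractible (k : ℕ) {c : SC (Fin n → ℝ) (k + 1)}
    (hc : c ∈ Zc (k + 1) (Set.univ : Set (Fin n → ℝ))) :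
    c ∈ Bc (k + 1) (Set.univ : Set (Fin n → ℝ)) := by
  have h := homotopy_id (ContinuousMap.const _ 0) (V := Set.univ) (fun _ _ _ _ => trivial) hc
  obtain ⟨m, hm⟩ := push_const (k + 1) (0 : Fin n → ℝ) c
  have h2 : push (ContinuousMap.const _ (0 : Fin n → ℝ)) (k + 1) c ∈
      Bc (k + 1) (Set.univ : Set (Fin n → ℝ)) := by
    rw [hm]
    by_cases hk : Even (k + 2)
    · refine ⟨m • Finsupp.single (ContinuousMap.const _ 0) 1, Submodule.smul_mem _ _
        (single_mem_sup fun t => trivial), ?_⟩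
      have hk' : ¬ Even (k + 1 + 2) := by
        intro h; rw [Nat.even_iff] at h hk; omega
      rw [map_smul, sbd_const, if_neg hk', one_smul]
    · have h3 := push_mem_Zc (ContinuousMap.const _ (0 : Fin n → ℝ)) (V := Set.univ)
        (fun _ _ => trivial) hc
      rw [hm] at h3
      have h4 : sbd _ k (m • Finsupp.single (ContinuousMap.const _ (0 : Fin n → ℝ)) 1) = 0 := h3.2
      rw [map_smul, sbd_const, if_neg hk, one_smul, Finsupp.smul_single,
        Finsupp.single_eq_zero] at h4
      simp only [smul_eq_mul, mul_one] at h4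
      rw [h4]; simp
  have := sub_mem h2 h
  simpa using this

/-- The operator attached to a letter. -/
noncomputable abbrev aa (k : ℕ) (α : Fin n × Bool) := push (uu α) k

lemma aa_Z {k : ℕ} {α : Fin n × Bool} {T : Finset (Fin n)} {c : SC (Fin n → ℝ) k}
    (hc : c ∈ Zc k (M (T.erase α.1))) : aa k α c ∈ Zc k (M T) :=
  push_mem_Zc _ (fun _ hx => uu_mem α T hx) hc

lemma aa_B {k : ℕ} {α : Fin n × Bool} {T : Finset (Fin n)} {c : SC (Fin n → ℝ) k}
    (hc : c ∈ Bc k (M (T.erase α.1))) : aa k α c ∈ Bc k (M T) :=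
  push_mem_Bc _ (fun _ hx => uu_mem α T hx) hc

lemma aa_comm {k : ℕ} {α β : Fin n × Bool} (h : α.1 ≠ β.1) {T : Finset (Fin n)}
    {c : SC (Fin n → ℝ) k} (hc : c ∈ Zc k (M ((T.erase α.1).erase β.1))) :
    aa k β (aa k α c) - aa k α (aa k β c) ∈ Bc k (M T) := by
  have := homotopy_line ((uu α).comp (uu β)) ((uu β).comp (uu α)) (V := M T)
    (fun x hx t ht => lineC α β T h hx ht) hc
  rwa [push_comp, push_comp] at this

lemma sup_empty (k : ℕ) {U : Set E} (hU : U = ∅) : sup k U = ⊥ := by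
  subst hU
  rw [eq_bot_iff]
  intro c hc
  have := (Finsupp.mem_supported ℤ c).1 hc
  rw [Submodule.mem_bot, ← Finsupp.support_eq_empty, Finset.eq_empty_iff_forall_notMem]
  intro σ hσ
  exact this hσ stdSimplex.barycenter

lemma sup_apply {k : ℕ} {U : Set E} {c : SC E k} (hc : c ∈ sup k U) {σ : Sing E k}
    (h : c σ ≠ 0) : ∀ t, σ t ∈ U :=
  (Finsupp.mem_supported ℤ c).1 hc (Finsupp.mem_support_iff.2 h)

lemma mem_sup_of {k : ℕ} {U : Set E} {c : SC E k} (h : ∀ σ, c σ ≠ 0 → ∀ t, σ t ∈ U) :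
    c ∈ sup k U :=
  (Finsupp.mem_supported ℤ c).2 fun σ hσ => h σ (Finsupp.mem_support_iff.1 hσ)

/-- Chains with disjoint supports. -/
lemma disj_apply {J : Type*} [Fintype J] {k : ℕ} {V : J → Set E}
    (hV : ∀ i j x, x ∈ V i → x ∈ V j → i = j) {c : J → SC E k} (hc : ∀ i, c i ∈ sup k (V i))
    (i : J) (σ : Sing E k) (hσ : ∀ t, σ t ∈ V i) : (∑ j, c j) σ = c i σ := by
  rw [Finsupp.finsetSum_apply]
  refine Finset.sum_eq_single i (fun j _ hj => ?_) (by simp)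
  by_contra hcon
  exact hj (hV j i _ (sup_apply (hc j) hcon stdSimplex.barycenter) (hσ _))

lemma disj_zero {J : Type*} [Fintype J] {k : ℕ} {V : J → Set E}
    (hV : ∀ i j x, x ∈ V i → x ∈ V j → i = j) {c : J → SC E k} (hc : ∀ i, c i ∈ sup k (V i))
    (h : ∑ j, c j = 0) (i : J) : c i = 0 := by
  ext σ
  by_contra hcon
  have h2 := disj_apply hV hc i σ (sup_apply (hc i) hcon)
  rw [h] at h2
  exact hcon h2.symm

lemma disj_pair {k : ℕ} {U V : Set E} (hUV : ∀ x, x ∈ U → x ∈ V → False) {c d c' d' : SC E k}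
    (hc : c ∈ sup k U) (hd : d ∈ sup k V) (hc' : c' ∈ sup k U) (hd' : d' ∈ sup k V)
    (h : c + d = c' + d') : c = c' := by
  have h3 : c - c' = d' - d := by rw [sub_eq_sub_iff_add_eq_add, h, add_comm]
  have h1 : c - c' ∈ sup k U := sub_mem hc hc'
  have h2 : c - c' ∈ sup k V := by rw [h3]; exact sub_mem hd' hd
  rw [← sub_eq_zero]
  ext σ
  by_contra hcon
  exact hUV _ (sup_apply h1 hcon stdSimplex.barycenter) (sup_apply h2 hcon _)

/-- Double decomposition. -/
lemma double {I J : Type*} [Fintype I] [Fintype J] {k : ℕ} {U : I → Set E} {V : J → Set E}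
    (hU : ∀ i j x, x ∈ U i → x ∈ U j → i = j) (hV : ∀ i j x, x ∈ V i → x ∈ V j → i = j)
    {x : I → SC E k} {q : J → SC E k} (hx : ∀ i, x i ∈ sup k (U i)) (hq : ∀ j, q j ∈ sup k (V j))
    (h : ∑ i, x i = ∑ j, q j) :
    ∃ v : I → J → SC E k, (∀ i j, v i j ∈ sup k (U i ∩ V j)) ∧ (∀ i, x i = ∑ j, v i j) ∧
      ∀ j, q j = ∑ i, v i j := by
  classical
  let v : I → J → SC E k := fun i j => (x i).filter fun σ => ∀ t, σ t ∈ V j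
  have hv : ∀ i j, v i j ∈ sup k (U i ∩ V j) := by
    intro i j
    refine mem_sup_of fun σ hσ t => ?_
    by_cases hh : ∀ t, σ t ∈ V j
    · rw [Finsupp.filter_apply_pos (p := fun σ : Sing E k => ∀ t, σ t ∈ V j) _ hh] at hσ
      exact ⟨sup_apply (hx i) hσ t, hh t⟩
    · exact absurd (Finsupp.filter_apply_neg (p := fun σ : Sing E k => ∀ t, σ t ∈ V j) _ hh) hσ
  refine ⟨v, hv, fun i => ?_, fun j => ?_⟩
  · ext σ
    by_cases hσ : ∃ j, ∀ t, σ t ∈ V j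
    · obtain ⟨j, hj⟩ := hσ
      rw [disj_apply hV (fun j => sup_mono Set.inter_subset_right (hv i j)) j σ hj]
      exact (Finsupp.filter_apply_pos (p := fun σ : Sing E k => ∀ t, σ t ∈ V j) _ hj).symm
    · have h1 : (∑ j, v i j) σ = 0 := by
        rw [Finsupp.finsetSum_apply]
        refine Finset.sum_eq_zero fun j _ => ?_
        by_contra hcon
        exact hσ ⟨j, fun t => (sup_apply (hv i j) hcon t).2⟩
      rw [h1]
      by_contra hcon
      have h2 := disj_apply hU hx i σ (sup_apply (hx i) hcon)
      rw [h, Finsupp.finsetSum_apply] at h2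
      rw [← h2] at hcon
      obtain ⟨j, _, hj⟩ := Finset.exists_ne_zero_of_sum_ne_zero hcon
      exact hσ ⟨j, sup_apply (hq j) hj⟩
  · ext σ
    by_cases hσ : ∀ t, σ t ∈ V j
    · rw [← disj_apply hV hq j σ hσ, ← h, Finsupp.finsetSum_apply, Finsupp.finsetSum_apply]
      refine Finset.sum_congr rfl fun i _ => ?_
      exact (Finsupp.filter_apply_pos (p := fun σ : Sing E k => ∀ t, σ t ∈ V j) _ hσ).symm
    · have h1 : q j σ = 0 := by
        by_contra hcon
        exact hσ (sup_apply (hq j) hcon)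
      rw [h1, Finsupp.finsetSum_apply]
      symm
      refine Finset.sum_eq_zero fun i _ => ?_
      exact Finsupp.filter_apply_neg (p := fun σ : Sing E k => ∀ t, σ t ∈ V j) _ hσ

/-- The geometric decomposition. -/
lemma geoD (N : Finset (Fin n)) {k : ℕ} {x : Fin n × Bool → SC (Fin n → ℝ) k}
    {q : Fin n × Bool → Fin n × Bool → SC (Fin n → ℝ) k} (hx : ∀ α, x α ∈ sup k (rA N α))
    (hq : ∀ α β, q α β ∈ sup k (rB N α β)) (h : ∑ α, x α = ∑ α, ∑ β, q α β) :
    ∃ v : Fin n × Bool → Fin n × Bool → SC (Fin n → ℝ) k,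
      (∀ α β, v α β ∈ sup k (rR N α β)) ∧ (∀ α, x α = ∑ β, v α β) ∧
      ∀ α β, v α β + v β α = q α β + q β α := by
  obtain ⟨v, hv, h1, h2⟩ := double (I := Fin n × Bool) (J := (Fin n × Bool) × (Fin n × Bool))
    (U := rA N) (V := fun p => rB N p.1 p.2) (x := x) (q := fun p => q p.1 p.2)
    (fun i j x hi hj => rA_disj N hi hj)
    (fun i j x hi hj => Prod.ext_iff.2 (rB_disj N hi hj)) hx (fun p => hq p.1 p.2)
    (by rw [h]; exact (Fintype.sum_prod_type' q).symm)
  have hz : ∀ γ α β, γ ≠ α → γ ≠ β → v γ (α, β) = 0 := by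
    intro γ α β ha hb
    have := hv γ (α, β)
    rw [sup_empty] at this
    · exact this
    · rw [Set.eq_empty_iff_forall_notMem]
      rintro y ⟨hy1, hy2⟩
      rcases rAB_disj N hy1 hy2 with h | h
      · exact ha h
      · exact hb h
  have hd : ∀ γ α, v γ (α, α) = 0 := by
    intro γ α
    have := hv γ (α, α)
    rw [sup_empty] at this
    · exact this
    · rw [Set.eq_empty_iff_forall_notMem]
      rintro y ⟨hy1, hy2⟩
      exact lt_irrefl _ hy2.1
  have h2' : ∀ α β, α ≠ β → q α β = v α (α, β) + v β (α, β) := by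
    intro α β hab
    have := h2 (α, β)
    simp only at this
    rw [this]
    refine Finset.sum_eq_add (a := α) (b := β) hab (fun γ _ hγ => hz γ α β hγ.1 hγ.2) (by simp)
      (by simp)
  refine ⟨fun α β => v α (α, β) + v α (β, α), fun α β => add_mem ?_ ?_, fun α => ?_,
    fun α β => ?_⟩
  · exact sup_mono (rA_inter_rB N α β) (hv α (α, β))
  · exact sup_mono (rA_inter_rB' N α β) (hv α (β, α))
  · rw [h1 α, Finset.sum_add_distrib]
    refine (Fintype.sum_prod_type _).trans ?_
    have e : ∀ γ, ∑ β, v α (γ, β) = (if γ = α then ∑ β, v α (α, β) else 0) + v α (γ, α) := by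
      intro γ
      split_ifs with hγ
      · subst hγ; rw [hd, add_zero]
      · rw [zero_add]
        refine Finset.sum_eq_single α (fun β _ hβ => hz α γ β (Ne.symm hγ) hβ.symm) (by simp)
    rw [Finset.sum_congr rfl fun γ _ => e γ, Finset.sum_add_distrib,
      Finset.sum_ite_eq' Finset.univ α, if_pos (Finset.mem_univ α)]
  · by_cases hab : α = β
    · subst hab
      have : q α α = 0 := by
        rw [show q α α = ∑ i, v i (α, α) from h2 (α, α)]
        exact Finset.sum_eq_zero fun i _ => hd i α
      simp [hd, this]
    · rw [h2' α β hab, h2' β α (Ne.symm hab)]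
      beta_reduce
      generalize v α (α, β) = a, v α (β, α) = b, v β (α, β) = c, v β (β, α) = d
      abel

/-- The geometric cover. -/
def cov (N : Finset (Fin n)) :
    (Fin n × Bool) ⊕ ((Fin n × Bool) × (Fin n × Bool)) → Set (Fin n → ℝ)
  | Sum.inl α => rA N α
  | Sum.inr p => rB N p.1 p.2

lemma CS_sum (N : Finset (Fin n)) (k : ℕ) {c : SC (Fin n → ℝ) k}
    (hc : c ∈ CS k (cov N)) :
    ∃ (x : Fin n × Bool → SC (Fin n → ℝ) k)
      (q : Fin n × Bool → Fin n × Bool → SC (Fin n → ℝ) k), (∀ α, x α ∈ sup k (rA N α)) ∧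
      (∀ α β, q α β ∈ sup k (rB N α β)) ∧ c = ∑ α, x α + ∑ α, ∑ β, q α β := by
  rw [CS, Submodule.mem_iSup_iff_exists_finsupp] at hc
  obtain ⟨f, hf, hs⟩ := hc
  refine ⟨fun α => f (Sum.inl α), fun α β => f (Sum.inr (α, β)), fun α => hf (Sum.inl α),
    fun α β => hf (Sum.inr (α, β)), ?_⟩
  rw [← hs, Finsupp.sum_fintype _ _ (by simp), Fintype.sum_sum_type]
  congr 1
  exact Fintype.sum_prod_type _

lemma rA_CS (N : Finset (Fin n)) (k : ℕ) {c : SC (Fin n → ℝ) k} {α} (h : c ∈ sup k (rA N α)) :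
    c ∈ CS k (cov N) :=
  sup_le_CS k (cov N) (Sum.inl α) h

lemma rB_CS (N : Finset (Fin n)) (k : ℕ) {c : SC (Fin n → ℝ) k} {α β} (h : c ∈ sup k (rB N α β)) :
    c ∈ CS k (cov N) :=
  sup_le_CS k (cov N) (Sum.inr (α, β)) h

/-- Small chains for the geometric cover. -/
lemma geo_small (N : Finset (Fin n)) (hN : 3 ≤ N.card) (k : ℕ) {c : SC (Fin n → ℝ) (k + 1)}
    (hc : c ∈ sup (k + 1) (M N))
    (hb : sbd _ k c ∈ CS k (cov N)) :
    ∃ (x : Fin n × Bool → SC (Fin n → ℝ) (k + 1))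
      (q : Fin n × Bool → Fin n × Bool → SC (Fin n → ℝ) (k + 1)),
      (∀ α, x α ∈ sup (k + 1) (rA N α)) ∧
      (∀ α β, q α β ∈ sup (k + 1) (rB N α β)) ∧
      c - (∑ α, x α + ∑ α, ∑ β, q α β) ∈ Bc (k + 1) (M N) := by
  obtain ⟨c', h1, h2⟩ := small (V := cov N) (U := M N) (by
        rintro (α | p)
        · exact isOpen_rA N α
        · exact isOpen_rB N p.1 p.2) (by
        intro x hx
        rw [Set.mem_iUnion]
        rcases cover N hN hx with ⟨α, h⟩ | ⟨α, β, h⟩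
        · exact ⟨Sum.inl α, h⟩
        · exact ⟨Sum.inr (α, β), h⟩) k c hc hb
  obtain ⟨x, q, hx, hq, rfl⟩ := CS_sum N (k + 1) h1
  exact ⟨x, q, hx, hq, h2⟩

end Hom

end TypeD

namespace TypeD

section Key
variable {n : ℕ}

lemma uu_mem_rA (α : Fin n × Bool) (N : Finset (Fin n)) (hα : α.1 ∈ N) {x : Fin n → ℝ}
    (hx : x ∈ M (N.erase α.1)) : uu α x ∈ rA N α := by
  refine ⟨hα, M_congr hx fun k hk => (uu_ne α x (Finset.ne_of_mem_erase hk)).symm, ?_, ?_⟩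
  · rw [val_uu]; exact big_pos x
  · intro k hk
    rw [val_uu, uu_ne α x (Finset.ne_of_mem_erase hk)]; exact lt_big x k

lemma lineM (α : Fin n × Bool) (N : Finset (Fin n)) {x : Fin n → ℝ} (hx : x ∈ M (N.erase α.1))
    {t : ℝ} (_ : t ∈ Set.Icc (0 : ℝ) 1) : (1 - t) • x + t • uu α x ∈ M (N.erase α.1) :=
  M_congr hx fun _ hk => (line_eq (uu_ne α x (Finset.ne_of_mem_erase hk)) t).symm

/-- Exactness at the first spot. -/
def K1 (k : ℕ) (G N : Finset (Fin n)) : Prop :=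
  ∀ y : Fin n × Bool → SC (Fin n → ℝ) k, (∀ β, y β ∈ Zc k (M (N.erase β.1))) →
    (∀ β, β.1 ∉ G → y β = 0) → ∑ β, aa k β (y β) ∈ Bc k (M N) →
    ∃ w : Fin n × Bool → Fin n × Bool → SC (Fin n → ℝ) k,
      (∀ α β, w α β ∈ Zc k (M ((N.erase α.1).erase β.1))) ∧
      (∀ α β, α.1 ∉ G → w α β = 0) ∧ (∀ α β, β.1 ∉ G → w α β = 0) ∧
      (∀ α β, α.1 = β.1 → w α β = 0) ∧
      ∀ β, y β - ∑ α, aa k α (w α β - w β α) ∈ Bc k (M (N.erase β.1))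

/-- Decomposable classes. -/
def Eg (k : ℕ) (G N : Finset (Fin n)) (z : SC (Fin n → ℝ) k) : Prop :=
  ∃ y : Fin n × Bool → SC (Fin n → ℝ) k, (∀ β, y β ∈ Zc k (M (N.erase β.1))) ∧
    (∀ β, β.1 ∉ G → y β = 0) ∧ z - ∑ β, aa k β (y β) ∈ Bc k (M N)

/-- Torsion-freeness modulo decomposables. -/
def TF (k : ℕ) (G N : Finset (Fin n)) : Prop :=
  ∀ z ∈ Zc k (M N), ∀ c : ℤ, c ≠ 0 → Eg k G N (c • z) → Eg k G N z

lemma rR_sub_M (N : Finset (Fin n)) (α β : Fin n × Bool) :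
    rR N α β ⊆ M ((N.erase α.1).erase β.1) := fun _ hx => hx.2.2.2.1

lemma rB_sub_M (N : Finset (Fin n)) (α β : Fin n × Bool) :
    rB N α β ⊆ M ((N.erase α.1).erase β.1) := fun _ hx => hx.2.2.2.1

lemma rB_sub_M' (N : Finset (Fin n)) (α β : Fin n × Bool) :
    rB N α β ⊆ M ((N.erase β.1).erase α.1) := fun _ hx => by
  rw [Finset.erase_right_comm]; exact hx.2.2.2.1

lemma rR_empty (N : Finset (Fin n)) (α β : Fin n × Bool) (h : α.1 = β.1) : rR N α β = ∅ := by
  rw [Set.eq_empty_iff_forall_notMem]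
  intro x hx
  exact hx.1 h

lemma rA_empty (N : Finset (Fin n)) (α : Fin n × Bool) (h : α.1 ∉ N) : rA N α = ∅ := by
  rw [Set.eq_empty_iff_forall_notMem]
  intro x hx
  exact h hx.1

lemma aa_mem_rA {k : ℕ} {N : Finset (Fin n)} {y : Fin n × Bool → SC (Fin n → ℝ) k}
    (hy : ∀ β, y β ∈ Zc k (M (N.erase β.1))) (hy0 : ∀ β, β.1 ∉ N → y β = 0) (α : Fin n × Bool) :
    aa k α (y α) ∈ sup k (rA N α) := by
  by_cases h : α.1 ∈ N
  · exact push_mem_sup _ (fun x hx => uu_mem_rA α N h hx) (Zc_le _ _ (hy α))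
  · rw [hy0 α h, map_zero]; exact zero_mem _

lemma v_cycle {k : ℕ} {N : Finset (Fin n)} {v : Fin n × Bool → Fin n × Bool → SC (Fin n → ℝ) (k + 1)}
    (hv : ∀ α β, v α β ∈ sup (k + 1) (rR N α β)) {α : Fin n × Bool}
    (h : sbd _ k (∑ β, v α β) = 0) (β : Fin n × Bool) : v α β ∈ Zc (k + 1) (rR N α β) := by
  refine ⟨hv α β, ?_⟩
  rw [map_sum] at h
  exact disj_zero (V := fun β => rR N α β) (fun β γ x h1 h2 => rR_disj N h1 h2)
    (fun β => sbd_mem_sup (hv α β)) h β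

lemma h3 (k : ℕ) (N : Finset (Fin n)) (hN : 3 ≤ N.card) : K1 (k + 1) N N := by
  intro y hy hy0 hsum
  obtain ⟨u, hu, hue⟩ := hsum
  obtain ⟨x, q, hx, hq, hxq⟩ := geo_small N hN (k + 1) hu (by
    rw [hue]
    exact sum_mem fun α _ => rA_CS N _ (aa_mem_rA hy hy0 α))
  have e0 : sbd _ (k + 1) (u - (∑ α, x α + ∑ α, ∑ β, q α β)) = 0 := (Bc_le _ _ hxq).2
  rw [map_sub, hue, sub_eq_zero, map_add, map_sum, map_sum] at e0
  simp only [map_sum (sbd (Fin n → ℝ) (k + 1))] at e0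
  obtain ⟨v, hv, hv1, hv2⟩ := geoD N (x := fun α => aa (k + 1) α (y α) - sbd _ (k + 1) (x α))
    (q := fun α β => sbd _ (k + 1) (q α β))
    (fun α => sub_mem (aa_mem_rA hy hy0 α) (sbd_mem_sup (hx α)))
    (fun α β => sbd_mem_sup (hq α β))
    (by rw [Finset.sum_sub_distrib, e0, add_sub_cancel_left])
  have hvz : ∀ α β, v α β ∈ Zc (k + 1) (rR N α β) := by
    intro α β
    refine v_cycle hv ?_ β
    rw [← hv1, map_sub, sbd_sbd, sub_zero]
    exact (aa_Z (hy α)).2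
  have hvM : ∀ α β, v α β ∈ Zc (k + 1) (M ((N.erase α.1).erase β.1)) :=
    fun α β => Zc_mono (rR_sub_M N α β) (hvz α β)
  have hv0 : ∀ α β : Fin n × Bool, α.1 = β.1 → v α β = 0 := by
    intro α β h
    have := hv α β
    rwa [sup_empty _ (rR_empty N α β h)] at this
  have hvA : ∀ α β : Fin n × Bool, α.1 ∉ N → v α β = 0 := by
    intro α β h
    have := sup_mono (rR_sub_rA N α β) (hv α β)
    rwa [sup_empty _ (rA_empty N α h)] at this
  have hvB : ∀ α β : Fin n × Bool, β.1 ∉ N → v α β = 0 := by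
    intro α β h
    have := sup_mono (rR_sub_rA' N α β) (hv α β)
    rwa [sup_empty _ (rA_empty _ β (fun h' => h (Finset.mem_of_mem_erase h')))] at this
  refine ⟨fun β α => if α.1 < β.1 then v α β else 0, ?_, ?_, ?_, ?_, ?_⟩
  · intro β α
    beta_reduce
    split_ifs
    · rw [Finset.erase_right_comm]; exact hvM α β
    · exact zero_mem _
  · intro β α h
    beta_reduce
    rw [hvB α β h, ite_self]
  · intro β α h
    beta_reduce
    rw [hvA α β h, ite_self]
  · intro β α h
    beta_reduce
    rw [hv0 α β h.symm, ite_self]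
  · intro α
    beta_reduce
    have t1 : aa (k + 1) α (y α) - y α ∈ Bc (k + 1) (M (N.erase α.1)) :=
      homotopy_id (uu α) (fun x hx t ht => lineM α N hx ht) (hy α)
    have t2 : sbd _ (k + 1) (x α) ∈ Bc (k + 1) (M (N.erase α.1)) :=
      ⟨x α, sup_mono (fun _ h => h.2.1) (hx α), rfl⟩
    have t3 : ∀ β, v α β - aa (k + 1) β ((if α.1 < β.1 then v α β else 0) -
        (if β.1 < α.1 then v β α else 0)) ∈ Bc (k + 1) (M (N.erase α.1)) := by
      intro β
      have t4 : aa (k + 1) β (v α β) - v α β ∈ Bc (k + 1) (M (N.erase α.1)) :=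
        homotopy_id (uu β) (fun x hx t ht => lineA β (N.erase α.1) (rR_sub_rA' N α β hx) ht)
          (hvz α β)
      rcases lt_trichotomy α.1 β.1 with h | h | h
      · rw [if_pos h, if_neg h.asymm, sub_zero, ← neg_sub]
        exact neg_mem t4
      · rw [if_neg h.not_lt, if_neg h.not_gt, hv0 α β h]
        simp
      · rw [if_neg h.asymm, if_pos h, zero_sub, map_neg, sub_neg_eq_add]
        have t5 : aa (k + 1) β (v α β + v β α) ∈ Bc (k + 1) (M (N.erase α.1)) := by
          refine aa_B ?_
          rw [hv2, ← map_add]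
          exact ⟨_, add_mem (sup_mono (rB_sub_M N α β) (hq α β))
            (sup_mono (rB_sub_M' N β α) (hq β α)), rfl⟩
        have : v α β + aa (k + 1) β (v β α) =
            aa (k + 1) β (v α β + v β α) - (aa (k + 1) β (v α β) - v α β) := by
          rw [map_add]; abel
        rw [this]
        exact sub_mem t5 t4
    have t6 := sum_mem (t := Finset.univ) (fun β _ => t3 β)
    rw [Finset.sum_sub_distrib, ← hv1] at t6
    have := sub_mem (add_mem t6 t2) t1
    refine (congrArg (· ∈ Bc (k + 1) (M (N.erase α.1))) ?_).mp this
    abel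

/-- From the ambient partial complement back to the region. -/
lemma R_back {k : ℕ} {N : Finset (Fin n)} {α β : Fin n × Bool} {v : SC (Fin n → ℝ) k}
    (hv : v ∈ Zc k (rR N α β)) (hb : v ∈ Bc k (M ((N.erase α.1).erase β.1))) :
    v ∈ Bc k (rR N α β) := by
  by_cases h : α.1 ≠ β.1 ∧ α.1 ∈ N ∧ β.1 ∈ N
  · have t1 := homotopy_id ((uu α).comp (uu β)) (V := rR N α β)
      (fun x hx t ht => lineR α β N hx ht) hv
    have t2 := push_mem_Bc ((uu α).comp (uu β)) (V := rR N α β)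
      (fun x hx => uu_uu_mem_rR α β N h.2.1 h.2.2 h.1 hx) hb
    have := sub_mem t2 t1
    rwa [sub_sub_cancel] at this
  · have hE : rR N α β = ∅ := by
      rw [Set.eq_empty_iff_forall_notMem]
      intro x hx
      exact h ⟨hx.1, hx.2.1, hx.2.2.1⟩
    have h2 := Zc_le _ _ hv
    rw [sup_empty _ hE, Submodule.mem_bot] at h2
    rw [h2]; exact zero_mem _

lemma Eg_add {k : ℕ} {G N : Finset (Fin n)} {z z' : SC (Fin n → ℝ) k} (h : Eg k G N z)
    (h' : Eg k G N z') : Eg k G N (z + z') := by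
  obtain ⟨y, h1, h2, h3⟩ := h
  obtain ⟨y', h1', h2', h3'⟩ := h'
  refine ⟨y + y', fun β => add_mem (h1 β) (h1' β), fun β hβ => ?_, ?_⟩
  · simp [h2 β hβ, h2' β hβ]
  · have := add_mem h3 h3'
    simp only [Pi.add_apply, map_add, Finset.sum_add_distrib]
    rwa [add_sub_add_comm]

lemma Eg_of_Bc {k : ℕ} {G N : Finset (Fin n)} {z : SC (Fin n → ℝ) k} (h : z ∈ Bc k (M N)) :
    Eg k G N z :=
  ⟨0, fun β => zero_mem _, fun β _ => rfl, by simpa using h⟩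

lemma Eg_sum {J : Type*} {k : ℕ} {G N : Finset (Fin n)} {z : J → SC (Fin n → ℝ) k} (s : Finset J)
    (h : ∀ j ∈ s, Eg k G N (z j)) : Eg k G N (∑ j ∈ s, z j) := by
  classical
  induction s using Finset.induction_on with
  | empty => exact Eg_of_Bc (by simp)
  | insert a s ha ih =>
    rw [Finset.sum_insert ha]
    exact Eg_add (h a (Finset.mem_insert_self _ _))
      (ih fun j hj => h j (Finset.mem_insert_of_mem hj))

lemma Eg_aa {k : ℕ} {G N : Finset (Fin n)} {α : Fin n × Bool} (hα : α.1 ∈ G)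
    {z : SC (Fin n → ℝ) k} (hz : z ∈ Zc k (M (N.erase α.1))) : Eg k G N (aa k α z) := by
  classical
  refine ⟨Pi.single α z, fun β => ?_, fun β hβ => ?_, ?_⟩
  · by_cases h : β = α
    · subst h; rwa [Pi.single_eq_same]
    · rw [Pi.single_eq_of_ne h]; exact zero_mem _
  · by_cases h : β = α
    · subst h; exact absurd hα hβ
    · rw [Pi.single_eq_of_ne h]
  · rw [Finset.sum_eq_single α (fun β _ h => by rw [Pi.single_eq_of_ne h, map_zero]) (by simp),
      Pi.single_eq_same, sub_self]
    exact zero_mem _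

lemma h4 (k : ℕ) (N : Finset (Fin n)) (hN : 3 ≤ N.card)
    (hTF : ∀ T : Finset (Fin n), ∀ z ∈ Zc k (M T), ∀ c : ℤ, c ≠ 0 → c • z ∈ Bc k (M T) →
      z ∈ Bc k (M T)) : TF (k + 1) N N := by
  intro z hz c hc hE
  obtain ⟨y, hy, hy0, hyz⟩ := hE
  have hzb : sbd _ k z = 0 := hz.2
  obtain ⟨x, q, hx, hq, hxq⟩ := geo_small N hN k hz.1 (by rw [hzb]; exact zero_mem _)
  have e0 : sbd _ k (z - (∑ α, x α + ∑ α, ∑ β, q α β)) = 0 := (Bc_le _ _ hxq).2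
  rw [map_sub, hzb, sub_eq_zero, map_add, map_sum, map_sum] at e0
  simp only [map_sum (sbd (Fin n → ℝ) k)] at e0
  obtain ⟨v, hv, hv1, hv2⟩ := geoD N (x := fun α => - sbd _ k (x α))
    (q := fun α β => sbd _ k (q α β)) (fun α => neg_mem (sbd_mem_sup (hx α)))
    (fun α β => sbd_mem_sup (hq α β)) (by
      rw [Finset.sum_neg_distrib]; exact neg_eq_of_add_eq_zero_right e0.symm)
  have hb2 : c • (∑ α, x α + ∑ α, ∑ β, q α β) - ∑ β, aa (k + 1) β (y β) ∈ Bc (k + 1) (M N) := by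
    have := sub_mem hyz (Submodule.smul_mem _ c hxq)
    refine (congrArg (· ∈ Bc (k + 1) (M N)) ?_).mp this
    rw [smul_sub]; abel
  obtain ⟨u, hu, hue⟩ := hb2
  obtain ⟨x', q', hx', hq', hxq'⟩ := geo_small N hN (k + 1) hu (by
    rw [hue]
    refine sub_mem (Submodule.smul_mem _ _ (add_mem ?_ ?_)) ?_
    · exact sum_mem fun α _ => rA_CS N _ (hx α)
    · exact sum_mem fun α _ => sum_mem fun β _ => rB_CS N _ (hq α β)
    · exact sum_mem fun α _ => rA_CS N _ (aa_mem_rA hy hy0 α))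
  have e1 : sbd _ (k + 1) (u - (∑ α, x' α + ∑ α, ∑ β, q' α β)) = 0 := (Bc_le _ _ hxq').2
  rw [map_sub, hue, sub_eq_zero, map_add, map_sum, map_sum] at e1
  simp only [map_sum (sbd (Fin n → ℝ) (k + 1))] at e1
  obtain ⟨v', hv', -, hv2'⟩ := geoD N
    (x := fun α => aa (k + 1) α (y α) + sbd _ (k + 1) (x' α) - c • x α)
    (q := fun α β => c • q α β - sbd _ (k + 1) (q' α β))
    (fun α => sub_mem (add_mem (aa_mem_rA hy hy0 α) (sbd_mem_sup (hx' α)))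
      (Submodule.smul_mem _ _ (hx α)))
    (fun α β => sub_mem (Submodule.smul_mem _ _ (hq α β)) (sbd_mem_sup (hq' α β))) (by
      simp only [Finset.sum_sub_distrib, Finset.sum_add_distrib, ← Finset.smul_sum]
      rw [smul_add] at e1
      rw [← sub_eq_zero] at e1 ⊢
      rw [← neg_eq_zero, ← e1]
      abel)
  have hvz : ∀ α β, v α β ∈ Zc k (rR N α β) := by
    intro α β
    cases k with
    | zero => exact hv α β
    | succ k =>
      refine v_cycle hv ?_ β
      rw [← hv1, map_neg, sbd_sbd, neg_zero]
  have hvB : ∀ α β, v α β ∈ Bc k (rR N α β) := by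
    intro α β
    by_cases hab : α.1 = β.1
    · have := hv α β
      rw [sup_empty _ (rR_empty N α β hab), Submodule.mem_bot] at this
      rw [this]; exact zero_mem _
    · refine R_back (hvz α β) (hTF _ _ (Zc_mono (rR_sub_M N α β) (hvz α β)) c hc ?_)
      refine Bc_mono (rR_sub_M N α β) ⟨v' α β, hv' α β, ?_⟩
      refine disj_pair (U := rR N α β) (V := rR N β α) ?_ (sbd_mem_sup (hv' α β))
        (sbd_mem_sup (hv' β α)) (Submodule.smul_mem _ c (hv α β))
        (Submodule.smul_mem _ c (hv β α)) ?_
      · intro x h1 h2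
        exact hab (congrArg Prod.fst (rA_disj N (rR_sub_rA N α β h1) (rR_sub_rA N β α h2)))
      · rw [← map_add, hv2', ← smul_add, hv2, map_add, map_sub, map_sub, sbd_sbd, sbd_sbd,
          sub_zero, sub_zero, map_smul, map_smul, smul_add]
  choose p hp hpv using hvB
  have hp0 : ∀ α β : Fin n × Bool, α.1 = β.1 → p α β = 0 := by
    intro α β h
    have := hp α β
    rwa [sup_empty _ (rR_empty N α β h)] at this
  have hq0 : ∀ α β : Fin n × Bool, ¬ α.1 < β.1 → q α β = 0 := by
    intro α β h
    have := hq α β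
    rwa [sup_empty] at this
    rw [Set.eq_empty_iff_forall_notMem]
    intro x hx
    exact h hx.1
  have eA : ∀ α, Eg (k + 1) N N (x α + ∑ β, p α β) := by
    intro α
    have hZ : x α + ∑ β, p α β ∈ Zc (k + 1) (rA N α) := by
      refine ⟨add_mem (hx α) (sum_mem fun β _ => sup_mono (rR_sub_rA N α β) (hp α β)), ?_⟩
      change sbd _ k _ = 0
      rw [map_add, map_sum, Finset.sum_congr rfl (fun β _ => hpv α β), ← hv1, add_neg_cancel]
    by_cases hα : α.1 ∈ N
    · have h1 := homotopy_id (uu α) (fun x hx t ht => lineA α N hx ht) hZ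
      have h2 : Eg (k + 1) N N (aa (k + 1) α (x α + ∑ β, p α β)) :=
        Eg_aa hα (Zc_mono (fun x hx => hx.2.1) hZ)
      have h3 := Eg_add h2 (Eg_of_Bc (neg_mem h1))
      rwa [neg_sub, add_sub_cancel] at h3
    · have := Zc_le _ _ hZ
      rw [sup_empty _ (rA_empty N α hα), Submodule.mem_bot] at this
      rw [this]; exact Eg_of_Bc (zero_mem _)
  have eB : ∀ α β, Eg (k + 1) N N
      (q α β - (if α.1 < β.1 then p α β + p β α else 0)) := by
    intro α β
    by_cases hab : α.1 < β.1
    · rw [if_pos hab]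
      have hZ : q α β - (p α β + p β α) ∈ Zc (k + 1) (rB N α β) := by
        refine ⟨sub_mem (hq α β) (add_mem (sup_mono (rR_sub_rB N α β hab) (hp α β))
          (sup_mono (rR_sub_rB' N β α hab) (hp β α))), ?_⟩
        change sbd _ k _ = 0
        have := hv2 α β
        rw [hq0 β α hab.asymm, map_zero, add_zero] at this
        rw [map_sub, map_add, hpv, hpv, this, sub_self]
      by_cases hα : α.1 ∈ N
      · have h1 := homotopy_id ((uu α).comp (uu β)) (fun x hx t ht => lineB α β N hx ht) hZ
        rw [push_comp] at h1
        have h2 : Eg (k + 1) N N (aa (k + 1) α (aa (k + 1) β (q α β - (p α β + p β α)))) :=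
          Eg_aa hα (aa_Z (Zc_mono (rB_sub_M N α β) hZ))
        have h3 := Eg_add h2 (Eg_of_Bc (neg_mem h1))
        rwa [neg_sub, add_sub_cancel] at h3
      · have := Zc_le _ _ hZ
        rw [sup_empty _ (Set.eq_empty_iff_forall_notMem.2 fun x hx => hα hx.2.1),
          Submodule.mem_bot] at this
        rw [this]; exact Eg_of_Bc (zero_mem _)
    · rw [if_neg hab, hq0 α β hab, sub_zero]
      exact Eg_of_Bc (zero_mem _)
  have hsum : ∑ α : Fin n × Bool, ∑ β : Fin n × Bool, (if α.1 < β.1 then p α β + p β α else 0) =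
      ∑ α, ∑ β, p α β := by
    have : ∀ α β : Fin n × Bool, p α β = (if α.1 < β.1 then p α β else 0) +
        (if β.1 < α.1 then p α β else 0) := by
      intro α β
      rcases lt_trichotomy α.1 β.1 with h | h | h
      · rw [if_pos h, if_neg h.asymm, add_zero]
      · rw [hp0 α β h]; simp
      · rw [if_pos h, if_neg h.asymm, zero_add]
    rw [Finset.sum_congr rfl (fun α _ => Finset.sum_congr rfl (fun β _ => this α β))]
    simp only [Finset.sum_add_distrib]
    rw [Finset.sum_comm (f := fun α β : Fin n × Bool => if β.1 < α.1 then p α β else 0)]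
    simp only [← Finset.sum_add_distrib]
    refine Finset.sum_congr rfl fun α _ => Finset.sum_congr rfl fun β _ => ?_
    split_ifs <;> simp
  have hA := Eg_sum Finset.univ (fun α _ => eA α)
  have hB := Eg_sum Finset.univ (fun α _ => Eg_sum Finset.univ (fun β _ => eB α β))
  have hfin := Eg_add (Eg_of_Bc hxq) (Eg_add hA hB)
  simp only [Finset.sum_add_distrib, Finset.sum_sub_distrib] at hfin
  rw [hsum] at hfin
  refine (congrArg (Eg (k + 1) N N) ?_).mp hfin
  abel

end Key

end TypeD

namespace TypeD

section Zero
variable {E : Type*} [TopologicalSpace E]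

/-- Homologous zero-simplices. -/
def rel0 (U : Set E) : Setoid (Sing E 0) where
  r σ τ := (Finsupp.single σ 1 - Finsupp.single τ 1 : SC E 0) ∈ Bc 0 U
  iseqv := by
    refine ⟨fun σ => by rw [sub_self]; exact zero_mem _, fun {σ τ} h => ?_, fun {σ τ ρ} h h' => ?_⟩
    · have := neg_mem h
      rwa [neg_sub] at this
    · have := add_mem h h'
      rwa [sub_add_sub_cancel] at this

lemma tf0 (U : Set E) (z : SC E 0) (c : ℤ) (hc : c ≠ 0) (h : c • z ∈ Bc 0 U) : z ∈ Bc 0 U := by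
  let p : SC E 0 →ₗ[ℤ] (Quotient (rel0 U) →₀ ℤ) := Finsupp.lmapDomain ℤ ℤ (Quotient.mk (rel0 U))
  let ρ : (Quotient (rel0 U) →₀ ℤ) →ₗ[ℤ] SC E 0 := Finsupp.lmapDomain ℤ ℤ Quotient.out
  have h1 : ∀ z : SC E 0, z - ρ (p z) ∈ Bc 0 U := by
    intro z
    induction z using Finsupp.induction_linear with
    | zero => simp
    | add a b ha hb =>
      have := add_mem ha hb
      rw [map_add, map_add]
      rwa [add_sub_add_comm]
    | single σ a =>
      have e : (Finsupp.single σ a : SC E 0) = a • Finsupp.single σ 1 := by simp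
      rw [e, map_smul, map_smul, ← smul_sub]
      refine Submodule.smul_mem _ _ ?_
      have e2 : ρ (p (Finsupp.single σ 1)) =
          Finsupp.single (Quotient.out (Quotient.mk (rel0 U) σ)) 1 := by
        simp [p, ρ, Finsupp.mapDomain_single]
      rw [e2]
      exact Setoid.symm' (rel0 U) (Quotient.mk_out (s := rel0 U) σ)
  have h2 : ∀ w ∈ Bc 0 U, p w = 0 := by
    rintro w ⟨u, hu, rfl⟩
    have : sup 1 U ≤ LinearMap.ker (p.comp (sbd E 0)) := by
      unfold sup
      rw [Finsupp.supported_eq_span_single, Submodule.span_le]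
      rintro _ ⟨τ, hτ, rfl⟩
      change p (sbd E 0 _) = 0
      have hm : sbd E 0 (Finsupp.single τ 1) ∈ Bc 0 U :=
        ⟨_, single_mem_sup hτ, rfl⟩
      rw [sbd_single, Fin.sum_univ_two] at hm ⊢
      simp only [Fin.val_zero, Fin.val_one, pow_zero, pow_one, one_smul, neg_smul] at hm ⊢
      rw [← sub_eq_add_neg] at hm ⊢
      have hq : Quotient.mk (rel0 U) (τ.comp (face 0 0)) = Quotient.mk (rel0 U) (τ.comp (face 0 1)) :=
        Quotient.sound hm
      simp only [p, map_sub, Finsupp.lmapDomain_apply, Finsupp.mapDomain_single, hq, sub_self]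
    exact this hu
  have h3 := h2 _ h
  rw [map_smul] at h3
  have h4 : p z = 0 := (smul_eq_zero.1 h3).resolve_left hc
  have := h1 z
  rwa [h4, map_zero, sub_zero] at this

end Zero

section Ind
variable {n : ℕ}

lemma small_B (k : ℕ) (N : Finset (Fin n)) (hN : N.card ≤ 2) {z : SC (Fin n → ℝ) (k + 1)}
    (hz : z ∈ Zc (k + 1) (M N)) : z ∈ Bc (k + 1) (M N) := by
  rw [M_of_card hN] at hz ⊢
  exact contractible k hz

lemma K1_base (k : ℕ) (N : Finset (Fin n)) : K1 (k + 1) N N := by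
  by_cases hN : 3 ≤ N.card
  · exact h3 k N hN
  · intro y hy _ _
    refine ⟨fun _ _ => 0, fun _ _ => zero_mem _, fun _ _ _ => rfl, fun _ _ _ => rfl,
      fun _ _ _ => rfl, fun β => ?_⟩
    simp only [sub_self, map_zero, Finset.sum_const_zero, sub_zero]
    refine small_B k _ ?_ (hy β)
    have := Finset.card_le_card (Finset.erase_subset β.1 N)
    omega

lemma TF_base (k : ℕ) (N : Finset (Fin n))
    (hTF : ∀ T : Finset (Fin n), ∀ z ∈ Zc k (M T), ∀ c : ℤ, c ≠ 0 → c • z ∈ Bc k (M T) →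
      z ∈ Bc k (M T)) : TF (k + 1) N N := by
  by_cases hN : 3 ≤ N.card
  · exact h4 k N hN hTF
  · intro z hz _ _ _
    exact Eg_of_Bc (small_B k N (by omega) hz)

lemma sum_fst {A : Type*} [AddCommMonoid A] (j : Fin n) (g : Fin n × Bool → A) :
    ∑ α : Fin n × Bool, (if α.1 = j then g α else 0) = ∑ s, g (j, s) := by
  rw [Fintype.sum_prod_type, Finset.sum_eq_single j]
  · simp
  · intro i _ hi
    simp [hi]
  · simp

lemma K1_step {k : ℕ} {G N : Finset (Fin n)} {j : Fin n} (hj : j ∉ G)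
    (h1 : K1 k (insert j G) N) (h2 : K1 k G (N.erase j)) : K1 k G N := by
  intro y hy hy0 hsum
  obtain ⟨w, hw, hwl, hwr, hwd, hwy⟩ := h1 y hy
    (fun β hβ => hy0 β fun h => hβ (Finset.mem_insert_of_mem h)) hsum
  have hv : ∀ s : Bool, ∃ v : Fin n × Bool → Fin n × Bool → SC (Fin n → ℝ) k,
      (∀ α β, v α β ∈ Zc k (M (((N.erase j).erase α.1).erase β.1))) ∧
      (∀ α β, α.1 ∉ G → v α β = 0) ∧ (∀ α β, β.1 ∉ G → v α β = 0) ∧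
      (∀ α β, α.1 = β.1 → v α β = 0) ∧
      ∀ β, (w β (j, s) - w (j, s) β) - ∑ α, aa k α (v α β - v β α) ∈
        Bc k (M ((N.erase j).erase β.1)) := by
    intro s
    refine h2 (fun β => w β (j, s) - w (j, s) β) (fun β => ?_) (fun β hβ => ?_) ?_
    · refine sub_mem ?_ (hw (j, s) β)
      rw [Finset.erase_right_comm]
      exact hw β (j, s)
    · by_cases h : β.1 = j
      · simp only [hwd β (j, s) h, hwd (j, s) β h.symm, sub_self]
      · have h' : β.1 ∉ insert j G := by simp [h, hβ]
        simp only [hwl β (j, s) h', hwr (j, s) β h', sub_self]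
    · have := hwy (j, s)
      rw [hy0 (j, s) hj, zero_sub] at this
      have := neg_mem this
      rwa [neg_neg] at this
  choose v hvz hvl hvr hvd hvy using hv
  refine ⟨fun α β => (if α.1 ∈ G ∧ β.1 ∈ G then w α β else 0) - ∑ s, aa k (j, s) (v s α β),
    ?_, ?_, ?_, ?_, ?_⟩
  · intro α β
    refine sub_mem ?_ (sum_mem fun s _ => aa_Z ?_)
    · split_ifs
      · exact hw α β
      · exact zero_mem _
    · have := hvz s α β
      rw [Finset.erase_right_comm (a := j)] at this
      rwa [Finset.erase_right_comm (a := j)] at this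
  · intro α β h
    simp [h, hvl]
  · intro α β h
    simp [h, hvr]
  · intro α β h
    simp [hwd α β h, hvd _ α β h]
  · intro β
    beta_reduce
    by_cases hβ : β.1 ∈ G
    · have hβj : β.1 ≠ j := fun h => hj (h ▸ hβ)
      have t1 : ∑ α, aa k α (w α β - w β α) =
          ∑ α, aa k α ((if α.1 ∈ G ∧ β.1 ∈ G then w α β else 0) -
            (if β.1 ∈ G ∧ α.1 ∈ G then w β α else 0)) -
          ∑ s, aa k (j, s) (w β (j, s) - w (j, s) β) := by
        rw [← sum_fst j (fun α => aa k α (w β α - w α β)), ← Finset.sum_sub_distrib]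
        refine Finset.sum_congr rfl fun α _ => ?_
        by_cases h : α.1 = j
        · have h' : α.1 ∉ G := h ▸ hj
          rw [if_neg (fun h'' => h' h''.1), if_neg (fun h'' => h' h''.2), if_pos h]
          simp only [map_sub, map_zero]
          abel
        · by_cases h' : α.1 ∈ G
          · simp only [h', hβ, h, and_self, if_true, if_false, sub_zero]
          · have h'' : α.1 ∉ insert j G := by simp [h, h']
            simp [hwl α β h'', hwr β α h'']
      have t2 : ∀ s, aa k (j, s) (w β (j, s) - w (j, s) β) -
          ∑ α, aa k α (aa k (j, s) (v s α β - v s β α)) ∈ Bc k (M (N.erase β.1)) := by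
        intro s
        have a1 : aa k (j, s) ((w β (j, s) - w (j, s) β) - ∑ α, aa k α (v s α β - v s β α)) ∈
            Bc k (M (N.erase β.1)) := by
          refine aa_B ?_
          rw [Finset.erase_right_comm]
          exact hvy s β
        have a2 : ∀ α, aa k (j, s) (aa k α (v s α β - v s β α)) -
            aa k α (aa k (j, s) (v s α β - v s β α)) ∈ Bc k (M (N.erase β.1)) := by
          intro α
          by_cases h : α.1 = j
          · have h' : α.1 ∉ G := h ▸ hj
            rw [hvl s α β h', hvr s β α h']
            simp
          · refine aa_comm (α := α) (β := (j, s)) h ?_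
            have b1 := hvz s α β
            have b2 := hvz s β α
            have e1 : ((N.erase j).erase α.1).erase β.1 = ((N.erase β.1).erase α.1).erase j := by
              ext i; simp only [Finset.mem_erase]; tauto
            have e2 : ((N.erase j).erase β.1).erase α.1 = ((N.erase β.1).erase α.1).erase j := by
              ext i; simp only [Finset.mem_erase]; tauto
            rw [e1] at b1
            rw [e2] at b2
            exact sub_mem b1 b2
        have a3 := add_mem a1 (sum_mem (t := Finset.univ) fun α _ => a2 α)
        rw [map_sub, map_sum, Finset.sum_sub_distrib, sub_add_sub_cancel] at a3
        exact a3
      have t3 := sub_mem (hwy β) (sum_mem (t := Finset.univ) fun s _ => t2 s)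
      refine (congrArg (· ∈ Bc k (M (N.erase β.1))) ?_).mp t3
      rw [t1, Finset.sum_sub_distrib, Finset.sum_comm]
      simp only [map_sub, map_sum, Finset.sum_sub_distrib]
      abel
    · have : ∀ α : Fin n × Bool, (if α.1 ∈ G ∧ β.1 ∈ G then w α β else 0) -
          ∑ s, aa k (j, s) (v s α β) - ((if β.1 ∈ G ∧ α.1 ∈ G then w β α else 0) -
          ∑ s, aa k (j, s) (v s β α)) = 0 := by
        intro α
        simp [hβ, hvl _ β α hβ, hvr _ α β hβ]
      simp only [this, map_zero, Finset.sum_const_zero, sub_zero]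
      rw [hy0 β hβ]
      exact zero_mem _

lemma Eg_push {k : ℕ} {G N : Finset (Fin n)} {β : Fin n × Bool} (hj : β.1 ∉ G)
    {z : SC (Fin n → ℝ) k} (h : Eg k G (N.erase β.1) z) : Eg k G N (aa k β z) := by
  obtain ⟨t, ht, ht0, htz⟩ := h
  refine ⟨fun α => aa k β (t α), fun α => aa_Z ?_, fun α hα => ?_, ?_⟩
  · rw [Finset.erase_right_comm]; exact ht α
  · simp only [ht0 α hα, map_zero]
  · have a1 := aa_B htz
    have a2 : ∀ α, aa k β (aa k α (t α)) - aa k α (aa k β (t α)) ∈ Bc k (M N) := by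
      intro α
      by_cases h : α.1 ∈ G
      · refine aa_comm (fun h' => hj (h' ▸ h)) ?_
        rw [Finset.erase_right_comm]; exact ht α
      · rw [ht0 α h]; simp
    have a3 := add_mem a1 (sum_mem (t := Finset.univ) fun α _ => a2 α)
    rwa [map_sub, map_sum, Finset.sum_sub_distrib, sub_add_sub_cancel] at a3

lemma TF_step {k : ℕ} {G N : Finset (Fin n)} {j : Fin n} (hj : j ∉ G)
    (h0 : K1 k (insert j G) N) (h1 : TF k (insert j G) N) (h2 : TF k G (N.erase j)) :
    TF k G N := by
  intro z hz c hc hE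
  obtain ⟨y', hy', hy0', hyz'⟩ := hE
  obtain ⟨y, hy, hy0, hyz⟩ := h1 z hz c hc
    ⟨y', hy', fun β hβ => hy0' β fun h => hβ (Finset.mem_insert_of_mem h), hyz'⟩
  obtain ⟨w, hw, hwl, hwr, hwd, hwy⟩ := h0 (fun β => c • y β - y' β)
    (fun β => sub_mem (Submodule.smul_mem _ _ (hy β)) (hy' β))
    (fun β hβ => by
      simp only [hy0 β hβ, hy0' β fun h => hβ (Finset.mem_insert_of_mem h), smul_zero, sub_zero])
    (by
      have := sub_mem hyz' (Submodule.smul_mem _ c hyz)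
      refine (congrArg (· ∈ Bc k (M N)) ?_).mp this
      simp only [map_sub, map_smul, Finset.sum_sub_distrib, ← Finset.smul_sum, smul_sub]
      abel)
  have hyE : ∀ β : Fin n × Bool, β.1 = j → Eg k G (N.erase β.1) (y β) := by
    intro β hβ
    have hβG : β.1 ∉ G := hβ ▸ hj
    rw [hβ]
    refine h2 _ (by have := hy β; rwa [hβ] at this) c hc ⟨fun α => w α β - w β α, ?_, ?_, ?_⟩
    · intro α
      have b1 := hw α β
      have b2 := hw β α
      rw [hβ] at b1 b2
      rw [Finset.erase_right_comm] at b1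
      exact sub_mem b1 b2
    · intro α hα
      by_cases h : α.1 = j
      · simp only [hwd α β (h.trans hβ.symm), hwd β α (hβ.trans h.symm), sub_self]
      · have h' : α.1 ∉ insert j G := by simp [h, hα]
        simp only [hwl α β h', hwr β α h', sub_self]
    · have := hwy β
      simp only [hy0' β (hβ ▸ hj), sub_zero] at this
      rwa [hβ] at this
  have e : Eg k G N (∑ β, aa k β (y β)) := by
    refine Eg_sum _ fun β _ => ?_
    by_cases h : β.1 ∈ G
    · exact Eg_aa h (hy β)
    · by_cases h' : β.1 = j
      · exact Eg_push h (hyE β h')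
      · rw [hy0 β (by simp [h, h']), map_zero]
        exact Eg_of_Bc (zero_mem _)
  have := Eg_add (Eg_of_Bc hyz) e
  rwa [sub_add_cancel] at this

lemma K1_all (k m : ℕ) : ∀ G N : Finset (Fin n), G ⊆ N → (N \ G).card = m → K1 (k + 1) G N := by
  induction m with
  | zero =>
    intro G N hGN h
    have : N ⊆ G := Finset.sdiff_eq_empty_iff_subset.1 (Finset.card_eq_zero.1 h)
    rw [Finset.Subset.antisymm hGN this]
    exact K1_base k N
  | succ m ih =>
    intro G N hGN h
    obtain ⟨j, hj⟩ : (N \ G).Nonempty := Finset.card_pos.1 (by omega)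
    have hj' := Finset.mem_sdiff.1 hj
    refine K1_step hj'.2 (ih _ _ ?_ ?_) (ih _ _ ?_ ?_)
    · exact Finset.insert_subset hj'.1 hGN
    · rw [Finset.sdiff_insert, Finset.card_erase_of_mem hj, h]; rfl
    · exact fun i hi => Finset.mem_erase.2 ⟨fun h => hj'.2 (h ▸ hi), hGN hi⟩
    · rw [Finset.erase_sdiff_comm, Finset.card_erase_of_mem hj, h]; rfl

lemma TF_all (k m : ℕ)
    (hTF : ∀ T : Finset (Fin n), ∀ z ∈ Zc k (M T), ∀ c : ℤ, c ≠ 0 → c • z ∈ Bc k (M T) →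
      z ∈ Bc k (M T)) :
    ∀ G N : Finset (Fin n), G ⊆ N → (N \ G).card = m → TF (k + 1) G N := by
  induction m with
  | zero =>
    intro G N hGN h
    have : N ⊆ G := Finset.sdiff_eq_empty_iff_subset.1 (Finset.card_eq_zero.1 h)
    rw [Finset.Subset.antisymm hGN this]
    exact TF_base k N hTF
  | succ m ih =>
    intro G N hGN h
    obtain ⟨j, hj⟩ : (N \ G).Nonempty := Finset.card_pos.1 (by omega)
    have hj' := Finset.mem_sdiff.1 hj
    refine TF_step hj'.2 (K1_all k _ _ _ ?_ rfl) (ih _ _ ?_ ?_) (ih _ _ ?_ ?_)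
    · exact Finset.insert_subset hj'.1 hGN
    · exact Finset.insert_subset hj'.1 hGN
    · rw [Finset.sdiff_insert, Finset.card_erase_of_mem hj, h]; rfl
    · exact fun i hi => Finset.mem_erase.2 ⟨fun h => hj'.2 (h ▸ hi), hGN hi⟩
    · rw [Finset.erase_sdiff_comm, Finset.card_erase_of_mem hj, h]; rfl

theorem torsion_free (k : ℕ) : ∀ T : Finset (Fin n), ∀ z ∈ Zc k (M T), ∀ c : ℤ, c ≠ 0 →
    c • z ∈ Bc k (M T) → z ∈ Bc k (M T) := by
  induction k with
  | zero => intro T z _ c hc h; exact tf0 _ z c hc h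
  | succ k ih =>
    intro T z hz c hc h
    obtain ⟨y, -, hy0, hyz⟩ := TF_all k _ ih ∅ T (Finset.empty_subset _) rfl z hz c hc (Eg_of_Bc h)
    have : ∑ β, aa (k + 1) β (y β) = 0 :=
      Finset.sum_eq_zero fun β _ => by rw [hy0 β (Finset.notMem_empty _), map_zero]
    rwa [this, sub_zero] at hyz

end Ind

end TypeD

namespace TypeD

section Glue
variable {E : Type} [TopologicalSpace E] (U : Set E)

/-- Simplices of the subspace. -/
abbrev SS (k : ℕ) : Type :=
  (TopCat.toSSet.obj (TopCat.of U)).obj (Opposite.op (SimplexCategory.mk k))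

/-- A simplex of the subspace, as a simplex of the ambient space. -/
noncomputable def toS (k : ℕ) (σ : SS U k) : Sing E k :=
  (⟨Subtype.val, continuous_subtype_val⟩ : C(U, E)).comp
    (TopCat.toSSetObjEquiv (TopCat.of U) (Opposite.op (SimplexCategory.mk k)) σ)

lemma toS_inj (k : ℕ) : Function.Injective (toS U k) := by
  intro σ τ h
  apply (TopCat.toSSetObjEquiv (TopCat.of U) (Opposite.op (SimplexCategory.mk k))).injective
  refine ContinuousMap.ext fun t => ?_
  exact Subtype.ext (DFunLike.congr_fun h t)

lemma toS_mem (k : ℕ) (σ : SS U k) (t) : toS U k σ t ∈ U :=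
  (TopCat.toSSetObjEquiv (TopCat.of U) (Opposite.op (SimplexCategory.mk k)) σ t).2

lemma toS_surj (k : ℕ) (τ : Sing E k) (h : ∀ t, τ t ∈ U) : ∃ σ, toS U k σ = τ := by
  refine ⟨(TopCat.toSSetObjEquiv (TopCat.of U) (Opposite.op (SimplexCategory.mk k))).symm
    (⟨fun t => ⟨τ t, h t⟩, by fun_prop⟩ : C(Simp k, U)), ?_⟩
  ext t
  simp only [toS]
  rw [Equiv.apply_symm_apply]
  rfl

lemma toS_face (k : ℕ) (i : Fin (k + 2)) (σ : SS U (k + 1)) :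
    toS U k ((TopCat.toSSet.obj (TopCat.of U)).δ i σ) = (toS U (k + 1) σ).comp (face k i) := by
  ext t
  exact congrArg Subtype.val (TopCat.toSSetObjEquiv_δ_apply (X := TopCat.of U) σ i t)

/-- Comparison of chains. -/
noncomputable def phi0 (k : ℕ) : (SS U k →₀ ℤ) →ₗ[ℤ] SC E k :=
  Finsupp.lmapDomain ℤ ℤ (toS U k)

lemma phi0_inj (k : ℕ) : Function.Injective (phi0 U k) :=
  Finsupp.mapDomain_injective (toS_inj U k)

lemma phi0_single (k : ℕ) (σ : SS U k) :
    phi0 U k (Finsupp.single σ (1 : ℤ)) = Finsupp.single (toS U k σ) 1 :=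
  Finsupp.mapDomain_single

lemma phi0_range (k : ℕ) : LinearMap.range (phi0 U k) = sup k U := by
  apply le_antisymm
  · rintro _ ⟨z, rfl⟩
    induction z using Finsupp.induction_linear with
    | zero => rw [map_zero]; exact zero_mem _
    | add a b ha hb => rw [map_add]; exact add_mem ha hb
    | single σ a =>
      have e : (Finsupp.single σ a : _ →₀ ℤ) = a • Finsupp.single σ 1 := by simp
      rw [e, map_smul, phi0_single]
      exact Submodule.smul_mem _ _ (single_mem_sup (toS_mem U k σ))
  · unfold sup
    rw [Finsupp.supported_eq_span_single, Submodule.span_le]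
    rintro _ ⟨τ, hτ, rfl⟩
    obtain ⟨σ, rfl⟩ := toS_surj U k τ hτ
    exact ⟨_, phi0_single U k σ⟩

/-- The Mathlib differential on finitely supported functions. -/
noncomputable def dd (k : ℕ) : (SS U (k + 1) →₀ ℤ) →ₗ[ℤ] (SS U k →₀ ℤ) :=
  ((singularChainComplex (TopCat.of U)).d (k + 1) k).hom

lemma dd_eq (k : ℕ) : dd U k = ∑ i : Fin (k + 2), (-1 : ℤ) ^ (i : ℕ) •
    Finsupp.lmapDomain ℤ ℤ ((TopCat.toSSet.obj (TopCat.of U)).δ i) := by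
  have hd : (singularChainComplex (TopCat.of U)).d (k + 1) k = _ :=
    AlgebraicTopology.AlternatingFaceMapComplex.obj_d_eq _ k
  unfold dd
  rw [hd]
  refine (ModuleCat.hom_sum _ _).trans ?_
  refine Finset.sum_congr rfl fun i _ => ?_
  rfl

lemma phi0_d (k : ℕ) (z) : phi0 U k (dd U k z) = sbd E k (phi0 U (k + 1) z) := by
  have : (phi0 U k).comp (dd U k) = (sbd E k).comp (phi0 U (k + 1)) := by
    refine Finsupp.lhom_ext' fun σ => LinearMap.ext_ring ?_
    change phi0 U k (dd U k (Finsupp.single σ 1)) = sbd E k (phi0 U (k + 1) (Finsupp.single σ 1))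
    rw [phi0_single, sbd_single, dd_eq]
    simp only [LinearMap.sum_apply, LinearMap.smul_apply, map_sum, map_smul,
      Finsupp.lmapDomain_apply, Finsupp.mapDomain_single, phi0_single, toS_face]
  exact DFunLike.congr_fun this z

end Glue

lemma M_univ (n : ℕ) : M (Finset.univ : Finset (Fin n)) = typeDComplement n := by
  ext x
  have habs : ∀ ε : ℝ, (ε = 1 ∨ ε = -1) → ∀ a : ℝ, |ε * a| = |a| := by
    rintro ε (rfl | rfl) a <;> simp
  have hs : ∀ a b : ℝ, |a| = |b| → ∃ ε : ℝ, (ε = 1 ∨ ε = -1) ∧ a = ε * b := by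
    intro a b h
    rcases abs_eq_abs.1 h with h | h
    · exact ⟨1, Or.inl rfl, by rw [h, one_mul]⟩
    · exact ⟨-1, Or.inr rfl, by rw [h, neg_one_mul]⟩
  constructor
  · intro h i j l hij hjl ε₁ ε₂ ε₃ h1 h2 h3 ⟨e1, e2⟩
    refine h i (Finset.mem_univ _) j (Finset.mem_univ _) l (Finset.mem_univ _) hij.ne hjl.ne
      (hij.trans hjl).ne ?_ ?_
    · rw [← habs ε₁ h1 (x i), e1, habs ε₂ h2]
    · rw [← habs ε₂ h2 (x j), e2, habs ε₃ h3]
  · intro h i _ j _ l _ hij hjl hil e1 e2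
    have key : ∀ i j l : Fin n, i < j → j < l → |x i| = |x j| → |x j| = |x l| → False := by
      intro i j l hij hjl e1 e2
      obtain ⟨ε, hε, h1⟩ := hs _ _ e1
      obtain ⟨ε', hε', h2⟩ := hs _ _ (e1.trans e2)
      exact h i j l hij hjl 1 ε ε' (Or.inl rfl) hε hε' ⟨by rw [one_mul, h1], by rw [← h1, h2]⟩
    have e3 := e1.trans e2
    rcases lt_or_gt_of_ne hij with a | a <;> rcases lt_or_gt_of_ne hjl with b | b <;>
      rcases lt_or_gt_of_ne hil with c | c
    · exact key i j l a b e1 e2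
    · exact (a.trans (b.trans c)).false
    · exact key i l j c b e3 e2.symm
    · exact key l i j c a e3.symm e1
    · exact key j i l a c e1.symm e3
    · exact key j l i b c e2 e3.symm
    · exact (c.trans (b.trans a)).false
    · exact key l j i b a e2.symm e1.symm

/-- Reduction of torsion-freeness of homology to chains. -/
theorem chain_alg (C : ChainComplex (ModuleCat ℤ) ℕ) (i : ℕ) (c : ℤ)
    (h : ∀ z : C.X i, (∀ j, C.d i j z = 0) → ∀ w : C.X (i + 1), C.d (i + 1) i w = c • z →
      ∃ w', C.d (i + 1) i w' = z)
    (x : C.homology i) (hx : c • x = 0) : x = 0 := by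
  have hex : (ShortComplex.mk (C.toCycles (i + 1) i) (C.homologyπ i) (by simp)).Exact :=
    ShortComplex.exact_of_g_is_cokernel _ (C.homologyIsCokernel (i + 1) i (by simp))
  rw [ShortComplex.moduleCat_exact_iff] at hex
  obtain ⟨y, rfl⟩ := (ModuleCat.epi_iff_surjective (C.homologyπ i)).1 inferInstance x
  have hinj := (ModuleCat.mono_iff_injective (C.iCycles i)).1 inferInstance
  obtain ⟨w, hw⟩ := hex (c • y) (by change C.homologyπ i (c • y) = 0; rw [map_zsmul]; exact hx)
  change C.toCycles (i + 1) i w = c • y at hw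
  have ht : ∀ w, C.iCycles i (C.toCycles (i + 1) i w) = C.d (i + 1) i w := fun w => by
    rw [← ModuleCat.comp_apply, C.toCycles_i]
  obtain ⟨w', hw'⟩ := h (C.iCycles i y) (fun j => by
    rw [← ModuleCat.comp_apply, C.iCycles_d]; rfl) w (by rw [← ht, hw, map_zsmul])
  rw [← ht] at hw'
  rw [← hinj hw', ← ModuleCat.comp_apply, C.toCycles_comp_homologyπ]
  rfl

theorem glue {E : Type} [TopologicalSpace E] (U : Set E) (i : ℕ)
    (h : ∀ z ∈ Zc i U, ∀ c : ℤ, c ≠ 0 → c • z ∈ Bc i U → z ∈ Bc i U) (c : ℤ) (hc : c ≠ 0)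
    (x : singularHomology (TopCat.of U) i) (hx : c • x = 0) : x = 0 := by
  refine chain_alg (singularChainComplex (TopCat.of U)) i c ?_ x hx
  intro z hz w hw
  change SS U i →₀ ℤ at z
  change SS U (i + 1) →₀ ℤ at w
  change dd U i w = c • z at hw
  change ∃ w', dd U i w' = z
  have hb : phi0 U i z ∈ Bc i U := by
    refine h _ ?_ c hc ?_
    · have hs : phi0 U i z ∈ sup i U := by
        rw [← phi0_range]; exact ⟨_, rfl⟩
      cases i with
      | zero => exact hs
      | succ i =>
        refine ⟨hs, ?_⟩
        change sbd E i _ = 0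
        have hzi : dd U i z = 0 := hz i
        rw [← phi0_d, hzi, map_zero]
    · refine ⟨phi0 U (i + 1) w, ?_, ?_⟩
      · change _ ∈ sup (i + 1) U
        rw [← phi0_range]; exact ⟨_, rfl⟩
      · rw [← phi0_d, hw, map_smul]
  obtain ⟨u, hu, hue⟩ := hb
  change u ∈ sup (i + 1) U at hu
  rw [← phi0_range] at hu
  obtain ⟨w', rfl⟩ := hu
  rw [← phi0_d] at hue
  exact ⟨w', phi0_inj U i hue⟩

end TypeD

theorem homology_of_typeD_complement_torsionFree (n : ℕ) (hn : 3 ≤ n) (i : ℕ) :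
    ∀ c : ℤ, c ≠ 0 →
      ∀ x : (singularHomology (TopCat.of (typeDComplement n)) i), c • x = 0 → x = 0 := by
  intro c hc x hx
  refine TypeD.glue (typeDComplement n) i ?_ c hc x hx
  rw [← TypeD.M_univ]
  exact TypeD.torsion_free i _
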